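/- Let k be an algebraically closed field and let Ro_m be the rook monoid (symmetric inverse monoid) on m points, realized as the monoid, under composition, of all maps f : {0,1,…,m} → {0,1,…,m} satisfying f(0) = 0 and such that f(a) = f(b) ≠ 0 implies a = b; its group of units is isomorphic to the symmetric group S_m. Let V be a nonzero finite-dimensional kRo_m-module, given by ρ, such that ρ(x) = id_V implies x = 1, and let S_1,…,S_N be a complete list of pairwise non-isomorphic simple modules over the group algebra k[S_m]. Then there is a function b : ℕ → ℕ such that for every n the module V^{⊗n} is a direct sum of b(n) indecomposable k[Ro_m]-submodules, and b(n)/a(n) → 1 as n → ∞, where a(n) = ((dim_k V)^n/m!)·∑_{i=1}^N dim_k S_i. -/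

import Mathlib

open scoped TensorProduct

noncomputable section

/-- The diagonal action of a monoid `M` on the `n`-th tensor power of a module `V`,
`m ↦ ρ(m)^{⊗n}`. -/
def Representation.tensorPower {k M V : Type*} [CommSemiring k] [Monoid M]
    [AddCommMonoid V] [Module k V] (ρ : Representation k M V) (n : ℕ) :
    Representation k M (⨂[k]^n V) where
  toFun m := PiTensorProduct.map fun _ => ρ m
  map_one' := by
    simp only [map_one]
    exact PiTensorProduct.map_one
  map_mul' m m' := by
    simp only [map_mul]
    exact PiTensorProduct.map_mul _ _

/-- A module is indecomposable if it is nonzero and not the direct sum of two nonzero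
submodules. -/
def IsIndecomposableModule (R X : Type*) [Semiring R] [AddCommMonoid X] [Module R X] : Prop :=
  Nontrivial X ∧ ∀ A B : Submodule R X, IsCompl A B → A = ⊥ ∨ B = ⊥

/-- The rook monoid (symmetric inverse monoid) on `m` points, realized as the monoid of
all maps `f : {0,1,…,m} → {0,1,…,m}` (under composition) satisfying `f(0) = 0` and such
that `f(a) = f(b) ≠ 0` implies `a = b`; the element `0` plays the role of `undefined`,
so these are exactly the partial injections of `{1,…,m}`. -/
def RookMonoid (m : ℕ) : Submonoid (Function.End (Fin (m + 1))) where
  carrier := {f | f 0 = 0 ∧ ∀ a b : Fin (m + 1), f a = f b → f a ≠ 0 → a = b}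
  one_mem' := ⟨rfl, fun _ _ h _ => h⟩
  mul_mem' := by
    rintro f g ⟨hf0, hf⟩ ⟨hg0, hg⟩
    constructor
    · show f (g 0) = 0
      rw [hg0, hf0]
    · intro a b hab hne
      have h1 : g a = g b := hf (g a) (g b) hab hne
      have h2 : g a ≠ 0 := by
        intro h
        exact hne (by show f (g a) = 0; rw [h, hf0])
      exact hg a b h1 h2

section LatticeDecomposition

/-- An element of a lattice is indecomposable if it is not `⊥` and not the join of two disjoint
elements different from `⊥`. -/
def IsIndec {L : Type*} [Lattice L] [OrderBot L] (b : L) : Prop :=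
  b ≠ ⊥ ∧ ∀ x y : L, Disjoint x y → x ⊔ y = b → x = ⊥ ∨ y = ⊥

/-- `IndecDecomp a n` says that `a` is an independent join of `n` indecomposable elements. -/
inductive IndecDecomp {L : Type*} [Lattice L] [OrderBot L] : L → ℕ → Prop
  | bot : IndecDecomp ⊥ 0
  | sup {a b : L} {n : ℕ} :
      IndecDecomp a n → Disjoint a b → IsIndec b → IndecDecomp (a ⊔ b) (n + 1)

variable {L L' : Type*} [Lattice L] [OrderBot L] [Lattice L'] [OrderBot L']

theorem IsIndec.indecDecomp {b : L} (hb : IsIndec b) : IndecDecomp b 1 := by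
  simpa using IndecDecomp.sup .bot disjoint_bot_left hb

theorem IndecDecomp.add [IsModularLattice L] {a b : L} {n p : ℕ} (ha : IndecDecomp a n)
    (hb : IndecDecomp b p) (hab : Disjoint a b) : IndecDecomp (a ⊔ b) (n + p) := by
  induction hb with
  | bot => simpa using ha
  | @sup b c p hb hbc hc ih =>
    rw [← sup_assoc, ← add_assoc]
    exact (ih (hab.mono_right le_sup_left)).sup
      (hbc.disjoint_sup_left_of_disjoint_sup_right hab) hc

/-- Decompositions are transported along order embeddings whose range is a lower set. -/
theorem IndecDecomp.map (φ : L ↪o L') (hφ : ∀ (b : L) (y : L'), y ≤ φ b → ∃ x, φ x = y)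
    {a : L} {n : ℕ} (ha : IndecDecomp a n) : IndecDecomp (φ a) n := by
  have hbot : φ ⊥ = ⊥ := by
    obtain ⟨x, hx⟩ := hφ ⊥ ⊥ bot_le
    exact le_bot_iff.1 (hx ▸ φ.monotone bot_le)
  have hsup (a b : L) : φ (a ⊔ b) = φ a ⊔ φ b := by
    have hle : φ a ⊔ φ b ≤ φ (a ⊔ b) :=
      sup_le (φ.monotone le_sup_left) (φ.monotone le_sup_right)
    obtain ⟨x, hx⟩ := hφ _ _ hle
    refine le_antisymm ?_ hle
    rw [← hx]
    refine φ.monotone (sup_le (φ.le_iff_le.1 ?_) (φ.le_iff_le.1 ?_)) <;> simp [hx]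
  have hdisj {a b : L} : Disjoint a b ↔ Disjoint (φ a) (φ b) := by
    refine ⟨fun h => disjoint_iff_inf_le.2 ?_, fun h => disjoint_iff_inf_le.2 ?_⟩
    · obtain ⟨x, hx⟩ := hφ a (φ a ⊓ φ b) inf_le_left
      have hxa : x ≤ a := φ.le_iff_le.1 (hx ▸ inf_le_left)
      have hxb : x ≤ b := φ.le_iff_le.1 (hx ▸ inf_le_right)
      rw [← hx, le_bot_iff.1 (h hxa hxb), hbot]
    · exact φ.le_iff_le.1 (hbot ▸ h (φ.monotone inf_le_left) (φ.monotone inf_le_right))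
  induction ha with
  | bot => rw [hbot]; exact .bot
  | @sup a b n ha hab hb ih =>
    rw [hsup]
    refine ih.sup (hdisj.1 hab) ⟨fun h => hb.1 (φ.injective (h.trans hbot.symm)), ?_⟩
    intro x y hxy hxyb
    obtain ⟨x, rfl⟩ := hφ b x (hxyb ▸ le_sup_left)
    obtain ⟨y, rfl⟩ := hφ b y (hxyb ▸ le_sup_right)
    rw [← hsup] at hxyb
    rw [← hbot, φ.injective.eq_iff, φ.injective.eq_iff]
    exact hb.2 x y (hdisj.2 hxy) (φ.injective hxyb)

theorem IndecDecomp.biSup {L ι : Type*} [CompleteLattice L] [IsModularLattice L] {f : ι → L}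
    (hf : iSupIndep f) {n : ℕ} (h : ∀ i, IndecDecomp (f i) n) (s : Finset ι) :
    IndecDecomp (⨆ i ∈ s, f i) (s.card * n) := by
  classical
  induction s using Finset.induction_on with
  | empty => simpa using IndecDecomp.bot
  | insert i s hi ih =>
    rw [Finset.iSup_insert, Finset.card_insert_of_notMem hi, add_mul, one_mul, add_comm]
    exact (h i).add ih (hf.disjoint_biSup (y := (s : Set ι)) (by simpa using hi))

section Rank

variable (r : L → ℕ) (hr : ∀ a b, Disjoint a b → r (a ⊔ b) = r a + r b)
  (hr0 : ∀ a, r a = 0 ↔ a = ⊥)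

include hr hr0

theorem exists_indecDecomp_le [IsModularLattice L] (a : L) : ∃ n ≤ r a, IndecDecomp a n := by
  induction h : r a using Nat.strong_induction_on generalizing a with
  | _ N ih =>
    by_cases ha : a = ⊥
    · exact ⟨0, Nat.zero_le _, ha ▸ .bot⟩
    by_cases hi : IsIndec a
    · exact ⟨1, h ▸ Nat.one_le_iff_ne_zero.2 fun h0 => ha ((hr0 a).1 h0), hi.indecDecomp⟩
    obtain ⟨x, y, hxy, rfl, hx, hy⟩ :
        ∃ x y, Disjoint x y ∧ x ⊔ y = a ∧ x ≠ ⊥ ∧ y ≠ ⊥ := by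
      simp only [IsIndec, not_and, not_forall, not_or] at hi
      obtain ⟨x, y, hxy, h1, h2, h3⟩ := hi ha
      exact ⟨x, y, hxy, h1, h2, h3⟩
    rw [hr x y hxy] at h
    have hx0 := mt (hr0 x).1 hx
    have hy0 := mt (hr0 y).1 hy
    obtain ⟨p, hp, hp'⟩ := ih (r x) (by lia) x rfl
    obtain ⟨q, hq, hq'⟩ := ih (r y) (by lia) y rfl
    exact ⟨p + q, by lia, hp'.add hq' hxy⟩

theorem IndecDecomp.eq_rank (h1 : ∀ b, IsIndec b → r b = 1) {a : L} {n : ℕ}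
    (ha : IndecDecomp a n) : n = r a := by
  induction ha with
  | bot => exact ((hr0 ⊥).2 rfl).symm
  | sup _ hab hb ih => rw [hr _ _ hab, ← ih, h1 _ hb]

end Rank

end LatticeDecomposition

section ModuleDecomposition

theorem isIndecomposableModule_of_isIndec {R X : Type*} [Ring R] [AddCommGroup X] [Module R X]
    {W : Submodule R X} (hW : IsIndec W) : IsIndecomposableModule R W := by
  refine ⟨(Submodule.nontrivial_iff_ne_bot).2 hW.1, fun A B hAB => ?_⟩
  have hinj : Function.Injective (Submodule.map W.subtype) :=
    Submodule.map_injective_of_injective W.injective_subtype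
  have := hW.2 (A.map W.subtype) (B.map W.subtype)
    (Submodule.disjoint_map W.injective_subtype hAB.disjoint)
    (by rw [← Submodule.map_sup, hAB.sup_eq_top, Submodule.map_top, Submodule.range_subtype])
  rwa [hinj.eq_iff' (Submodule.map_bot _), hinj.eq_iff' (Submodule.map_bot _)] at this

theorem IndecDecomp.exists_iSupIndep {R X : Type*} [Ring R] [AddCommGroup X] [Module R X]
    {W : Submodule R X} {n : ℕ} (h : IndecDecomp W n) :
    ∃ f : Fin n → Submodule R X, iSupIndep f ∧ ⨆ i, f i = W ∧ ∀ i, IsIndec (f i) := by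
  induction h with
  | bot => exact ⟨Fin.elim0, fun i => i.elim0, by simp, fun i => i.elim0⟩
  | @sup a b n _ hab hb ih =>
    obtain ⟨f, hf, rfl, hfi⟩ := ih
    have hsup : Finset.univ.sup (Fin.cons b f ∘ Fin.succEmb n) = ⨆ i, f i := by
      simp [Finset.sup_eq_iSup]
    refine ⟨Fin.cons b f, ?_, ?_, Fin.cases hb hfi⟩
    · rw [iSupIndep_iff_supIndep_univ, Fin.univ_succ, Finset.cons_eq_insert]
      refine Finset.SupIndep.insert ((Finset.supIndep_map (g := Fin.succEmb n)).2 ?_) ?_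
      · exact iSupIndep_iff_supIndep_univ.1 hf
      · rw [Finset.sup_map]
        erw [hsup]
        exact hab.symm
    · rw [← Finset.sup_univ_eq_iSup, Fin.univ_succ, Finset.sup_cons]
      erw [Finset.sup_map, hsup]
      exact sup_comm _ _

theorem IndecDecomp.exists_isInternal {R X : Type*} [Ring R] [AddCommGroup X] [Module R X]
    {n : ℕ} (h : IndecDecomp (⊤ : Submodule R X) n) :
    ∃ (ι : Type) (_ : Fintype ι) (_ : DecidableEq ι) (f : ι → Submodule R X),
      DirectSum.IsInternal f ∧ (∀ i, IsIndecomposableModule R (f i)) ∧ Fintype.card ι = n := by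
  obtain ⟨f, hf, hf', hfi⟩ := h.exists_iSupIndep
  exact ⟨Fin n, inferInstance, inferInstance, f,
    DirectSum.isInternal_submodule_of_iSupIndep_of_iSup_eq_top hf hf',
    fun i => isIndecomposableModule_of_isIndec (hfi i), Fintype.card_fin n⟩

end ModuleDecomposition

section Submodules

theorem finrank_restrictScalars_sup {k R X : Type*} [Field k] [Ring R] [Algebra k R]
    [AddCommGroup X] [Module k X] [Module R X] [IsScalarTower k R X] [FiniteDimensional k X]
    {a b : Submodule R X} (h : Disjoint a b) :
    Module.finrank k ((a ⊔ b).restrictScalars k) =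
      Module.finrank k (a.restrictScalars k) + Module.finrank k (b.restrictScalars k) := by
  have h' : a.restrictScalars k ⊓ b.restrictScalars k = ⊥ := by
    rw [← Submodule.restrictScalars_inf, h.eq_bot, Submodule.restrictScalars_bot]
  rw [Submodule.restrictScalars_sup, ← Submodule.finrank_sup_add_finrank_inf_eq, h']
  simp

theorem finrank_restrictScalars_eq_zero {k R X : Type*} [Field k] [Ring R] [Algebra k R]
    [AddCommGroup X] [Module k X] [Module R X] [IsScalarTower k R X] [FiniteDimensional k X]
    (a : Submodule R X) : Module.finrank k (a.restrictScalars k) = 0 ↔ a = ⊥ := by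
  rw [Submodule.finrank_eq_zero, Submodule.restrictScalars_eq_bot_iff]

theorem exists_indecDecomp_le_finrank (k : Type*) {R X : Type*} [Field k] [Ring R] [Algebra k R]
    [AddCommGroup X] [Module k X] [Module R X] [IsScalarTower k R X] [FiniteDimensional k X]
    (W : Submodule R X) :
    ∃ n ≤ Module.finrank k (W.restrictScalars k), IndecDecomp W n :=
  exists_indecDecomp_le _ (fun _ _ => finrank_restrictScalars_sup (k := k))
    finrank_restrictScalars_eq_zero W

/-- If the action on `X` is by linear combinations of the identity and of one idempotent, then
all indecomposable summands of `X` are one-dimensional. -/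
theorem IndecDecomp.eq_finrank_of_idempotent {k R X : Type*} [Field k] [Ring R] [Algebra k R]
    [AddCommGroup X] [Module k X] [Module R X] [IsScalarTower k R X] [FiniteDimensional k X]
    (e : R) (he : ∀ x : X, e • e • x = e • x)
    (h : ∀ a : R, ∃ s t : k, ∀ x : X, a • x = s • x + t • e • x) {n : ℕ}
    (hn : IndecDecomp (⊤ : Submodule R X) n) : n = Module.finrank k X := by
  rw [hn.eq_rank _ (fun _ _ => finrank_restrictScalars_sup (k := k))
    finrank_restrictScalars_eq_zero ?_, Submodule.restrictScalars_top, finrank_top]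
  have hsub (c : k) (U : Submodule k X) (hU : ∀ x ∈ U, e • x = c • x) :
      ∃ W : Submodule R X, W.restrictScalars k = U := by
    refine ⟨{ U with smul_mem' := fun a x hx => ?_ }, rfl⟩
    obtain ⟨s, t, hst⟩ := h a
    change a • x ∈ U
    rw [hst, hU x hx]
    exact U.add_mem (U.smul_mem _ hx) (U.smul_mem _ (U.smul_mem _ hx))
  have hres := Submodule.restrictScalars_injective k R X
  intro b hb
  obtain ⟨c, hc⟩ : ∃ c : k, ∀ x ∈ b, e • x = c • x := by
    let f : X →ₗ[k] X := Algebra.lsmul k k X e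
    have hf (x : X) : f x = e • x := rfl
    obtain ⟨W₁, hW₁⟩ := hsub 1 (b.restrictScalars k ⊓ LinearMap.ker (f - LinearMap.id))
      (fun x hx => by simpa [sub_eq_zero, hf] using hx.2)
    obtain ⟨W₀, hW₀⟩ := hsub 0 (b.restrictScalars k ⊓ LinearMap.ker f)
      (fun x hx => by simpa [hf] using hx.2)
    have h₁ (x : X) : x ∈ W₁ ↔ x ∈ b ∧ e • x = x := by
      rw [← Submodule.restrictScalars_mem k, hW₁]
      simp [sub_eq_zero, hf]
    have h₀ (x : X) : x ∈ W₀ ↔ x ∈ b ∧ e • x = 0 := by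
      rw [← Submodule.restrictScalars_mem k, hW₀]
      simp [hf]
    have hdisj : Disjoint W₁ W₀ := by
      rw [Submodule.disjoint_def]
      intro x hx hx'
      rw [← ((h₁ x).1 hx).2, ((h₀ x).1 hx').2]
    have hsup : W₁ ⊔ W₀ = b := by
      refine le_antisymm (sup_le (fun x hx => ((h₁ x).1 hx).1) fun x hx => ((h₀ x).1 hx).1) ?_
      intro x hx
      have hex := b.smul_mem e hx
      rw [← add_sub_cancel (e • x) x]
      exact Submodule.add_mem_sup ((h₁ _).2 ⟨hex, he x⟩)
        ((h₀ _).2 ⟨b.sub_mem hx hex, by rw [smul_sub, he, sub_self]⟩)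
    rcases hb.2 _ _ hdisj hsup with h' | h'
    · refine ⟨0, fun x hx => ?_⟩
      rw [zero_smul]
      rw [h', bot_sup_eq] at hsup
      exact ((h₀ x).1 (hsup ▸ hx)).2
    · refine ⟨1, fun x hx => ?_⟩
      rw [one_smul]
      rw [h', sup_bot_eq] at hsup
      exact ((h₁ x).1 (hsup ▸ hx)).2
  obtain ⟨x, hx, hx0⟩ := b.exists_mem_ne_zero_of_ne_bot hb.1
  obtain ⟨U, hU⟩ := Submodule.exists_isCompl ((k ∙ x))
  have hxb : (k ∙ x) ≤ b.restrictScalars k := by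
    rwa [Submodule.span_singleton_le_iff_mem]
  obtain ⟨W₁, hW₁⟩ := hsub c (k ∙ x) fun y hy => hc y (hxb hy)
  obtain ⟨W₂, hW₂⟩ := hsub c (U ⊓ b.restrictScalars k) fun y hy => hc y hy.2
  have hdisj : Disjoint W₁ W₂ := by
    rw [Submodule.disjoint_def]
    intro y hy hy'
    rw [← Submodule.restrictScalars_mem k, hW₁] at hy
    rw [← Submodule.restrictScalars_mem k, hW₂] at hy'
    exact Submodule.disjoint_def.1 hU.disjoint y hy hy'.1
  have hsup : W₁ ⊔ W₂ = b := by
    apply hres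
    rw [Submodule.restrictScalars_sup, hW₁, hW₂, ← sup_inf_assoc_of_le _ hxb, hU.sup_eq_top,
      top_inf_eq]
  rcases hb.2 _ _ hdisj hsup with h' | h'
  · rw [h', Submodule.restrictScalars_bot] at hW₁
    exact absurd (Submodule.span_singleton_eq_bot.1 hW₁.symm) hx0
  · rw [h', sup_bot_eq] at hsup
    rw [← hsup, hW₁, finrank_span_singleton hx0]

/-- A decomposition of a `B`-module `X` is also a decomposition of its image in an `A`-module,
provided that the actions of `A` and `B` on it have the same image. -/
theorem IndecDecomp.of_injective {A B X Y : Type*} [Ring A] [Ring B] [AddCommGroup X]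
    [AddCommGroup Y] [Module B X] [Module A Y] (f : X →+ Y) (hf : Function.Injective f)
    (hA : ∀ a : A, ∃ b : B, ∀ x, a • f x = f (b • x))
    (hB : ∀ b : B, ∃ a : A, ∀ x, f (b • x) = a • f x)
    (Z : Submodule A Y) (hZ : (Z : Set Y) = Set.range f) {n : ℕ}
    (h : IndecDecomp (⊤ : Submodule B X) n) : IndecDecomp Z n := by
  let φ : Submodule B X ↪o Submodule A Y := OrderEmbedding.ofMapLEIff
    (fun W =>
      { W.toAddSubmonoid.map (f : X →+ Y) with
        smul_mem' := by
          rintro a _ ⟨x, hx, rfl⟩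
          obtain ⟨b, hb⟩ := hA a
          exact ⟨b • x, W.smul_mem b hx, (hb x).symm⟩ })
    (fun W W' => by
      constructor
      · intro hle x hx
        obtain ⟨y, hy, hyx⟩ := hle ⟨x, hx, rfl⟩
        exact hf hyx ▸ hy
      · rintro hle _ ⟨x, hx, rfl⟩
        exact ⟨x, hle hx, rfl⟩)
  have hφ (W : Submodule B X) (y : Y) : y ∈ φ W ↔ ∃ x ∈ W, f x = y := Iff.rfl
  have hZφ : Z = φ ⊤ := by
    ext y
    rw [hφ, ← SetLike.mem_coe, hZ]
    simp
  rw [hZφ]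
  refine h.map φ fun W V hV => ?_
  refine ⟨{ V.toAddSubmonoid.comap f with
    smul_mem' := fun b x hx => ?_ }, ?_⟩
  · obtain ⟨a, ha⟩ := hB b
    change f (b • x) ∈ V
    rw [ha]
    exact V.smul_mem a hx
  · ext y
    rw [hφ]
    constructor
    · rintro ⟨x, hx, rfl⟩
      exact hx
    · intro hy
      obtain ⟨x, -, rfl⟩ := hV hy
      exact ⟨x, hy, rfl⟩

theorem IndecDecomp.pi {R X : Type*} [Ring R] [AddCommGroup X] [Module R X] {n : ℕ}
    (h : IndecDecomp (⊤ : Submodule R X) n) (f : ℕ) :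
    IndecDecomp (⊤ : Submodule R (Fin f → X)) (f * n) := by
  have hind : iSupIndep fun i : Fin f => LinearMap.range (LinearMap.single R (fun _ => X) i) := by
    rw [iSupIndep_def]
    intro i
    simpa using LinearMap.disjoint_single_single R (fun _ : Fin f => X) {i} {j | j ≠ i}
      (by simp)
  have := IndecDecomp.biSup hind (n := n) (fun i => h.of_injective
    (LinearMap.single R (fun _ => X) i).toAddMonoidHom
    (LinearMap.ker_eq_bot.1 (LinearMap.ker_single R (fun _ => X) i))
    (fun a => ⟨a, fun x => ((LinearMap.single R (fun _ => X) i).map_smul a x).symm⟩)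
    (fun a => ⟨a, fun x => (LinearMap.single R (fun _ => X) i).map_smul a x⟩) _
    (LinearMap.coe_range _)) Finset.univ
  simpa [LinearMap.iSup_range_single] using this

end Submodules

section RegularModule

theorem isIndec_span_of_idempotent {A B : Type*} [Ring A] [Ring B] (f : A →+* B)
    (hf : ∀ x ∈ RingHom.ker f, IsNilpotent x) {e : A} (he : IsIdempotentElem e) (he0 : e ≠ 0)
    (h : ∀ x : A, IsIdempotentElem x → e * x = x → x * e = x → f x = 0 ∨ f x = f e) :
    IsIndec (Ideal.span {e}) := by
  have hnil (x : A) (hx : IsIdempotentElem x) (hfx : f x = 0) : x = 0 := by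
    obtain ⟨n, hn⟩ := hf x hfx
    rw [← hx.pow_succ_eq n, pow_succ, hn, zero_mul]
  refine ⟨by simpa [Ideal.span_singleton_eq_bot] using he0, fun X Y hXY hsup => ?_⟩
  have hmem (x : A) (hx : x ∈ Ideal.span {e}) : x * e = x := by
    obtain ⟨a, rfl⟩ := Ideal.mem_span_singleton'.1 hx
    rw [mul_assoc, he.eq]
  obtain ⟨u, hu, v, hv, huv⟩ :=
    Submodule.mem_sup.1 (hsup.symm ▸ Ideal.mem_span_singleton_self e : e ∈ X ⊔ Y)
  have hue : u * u + u * v = u := by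
    rw [← mul_add, huv]
    exact hmem u (hsup ▸ Submodule.mem_sup_left hu)
  have hve : v * u + v * v = v := by
    rw [← mul_add, huv]
    exact hmem v (hsup ▸ Submodule.mem_sup_right hv)
  have huv0 : u * v = 0 := by
    refine Submodule.disjoint_def.1 hXY _ ?_ (Y.smul_mem u hv)
    rw [← eq_sub_iff_add_eq'] at hue
    exact hue ▸ X.sub_mem hu (X.smul_mem u hu)
  have hvu0 : v * u = 0 := by
    refine Submodule.disjoint_def.1 hXY _ (X.smul_mem v hu) ?_
    rw [← eq_sub_iff_add_eq] at hve
    exact hve ▸ Y.sub_mem hv (Y.smul_mem v hv)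
  rw [huv0, add_zero] at hue
  rw [hvu0, zero_add] at hve
  rcases h u hue (by rw [← huv, add_mul, hue, hvu0, add_zero])
    (by rw [← huv, mul_add, hue, huv0, add_zero]) with h' | h'
  · left
    rw [hnil u hue h', zero_add] at huv
    have : X ≤ Y := by
      refine le_sup_left.trans (hsup.le.trans ?_)
      rwa [Ideal.span_singleton_le_iff_mem, ← huv]
    exact disjoint_self.1 (hXY.mono_right this)
  · right
    rw [← huv, map_add, left_eq_add] at h'
    rw [hnil v hve h', add_zero] at huv
    have : Y ≤ X := by
      refine le_sup_right.trans (hsup.le.trans ?_)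
      rwa [Ideal.span_singleton_le_iff_mem, ← huv]
    exact disjoint_self.1 (hXY.mono_left this)

theorem CompleteOrthogonalIdempotents.indecDecomp {A ι : Type*} [Ring A] [Fintype ι] {e : ι → A}
    (he : CompleteOrthogonalIdempotents e) (h : ∀ i, IsIndec (Ideal.span {e i})) :
    IndecDecomp (⊤ : Submodule A A) (Fintype.card ι) := by
  have hind : iSupIndep fun i => Ideal.span {e i} := by
    rw [iSupIndep_def]
    intro i
    rw [Submodule.disjoint_def]
    intro x hx hx'
    have hker : ⨆ j, ⨆ (_ : j ≠ i), Ideal.span {e j} ≤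
        LinearMap.ker (LinearMap.toSpanSingleton A A (e i)) := by
      refine iSup₂_le fun j hj => ?_
      rw [Ideal.span_singleton_le_iff_mem]
      simpa using he.ortho hj
    have h0 : x * e i = 0 := by simpa using hker hx'
    obtain ⟨a, rfl⟩ := Ideal.mem_span_singleton'.1 hx
    rwa [mul_assoc, (he.idem i).eq] at h0
  have htop : ⨆ i, Ideal.span {e i} = ⊤ := by
    rw [Ideal.eq_top_iff_one, ← he.complete]
    exact Ideal.sum_mem _ fun i _ => Ideal.mem_iSup_of_mem i (Ideal.mem_span_singleton_self _)
  simpa [htop] using IndecDecomp.biSup hind (fun i => (h i).indecDecomp) Finset.univ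

variable {k A : Type} [Field k] [IsAlgClosed k] [Ring A] [Algebra k A] [FiniteDimensional k A]
  {N : ℕ} {S : Fin N → Type} [∀ i, AddCommGroup (S i)] [∀ i, Module A (S i)]
  [∀ i, Module k (S i)] [∀ i, IsScalarTower k A (S i)]

theorem finiteDimensional_of_isSimpleModule (k : Type) {A T : Type} [Field k] [Ring A]
    [Algebra k A] [FiniteDimensional k A] [AddCommGroup T] [Module A T] [Module k T]
    [IsScalarTower k A T] (hT : IsSimpleModule A T) : FiniteDimensional k T :=
  Module.Finite.trans A T

omit [FiniteDimensional k A] in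
theorem isScalar_of_pairwise_not_equiv [∀ i, FiniteDimensional k (S i)]
    (hsimple : ∀ i, IsSimpleModule A (S i))
    (hpairwise : ∀ i j, i ≠ j → IsEmpty (S i ≃ₗ[A] S j)) (φ : Module.End A (Π i, S i)) :
    ∃ c : Fin N → k, ∀ x i, φ x i = c i • x i := by
  have hoff (i j : Fin N) (hij : i ≠ j) :
      (LinearMap.proj i ∘ₗ φ ∘ₗ LinearMap.single A S j : S j →ₗ[A] S i) = 0 := by
    refine (LinearMap.bijective_or_eq_zero _).resolve_left fun hb => ?_
    exact (hpairwise j i hij.symm).false (LinearEquiv.ofBijective _ hb)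
  have hdiag (i : Fin N) := (IsSimpleModule.algebraMap_end_bijective_of_isAlgClosed
    (A := A) (V := S i) k).2 (LinearMap.proj i ∘ₗ φ ∘ₗ LinearMap.single A S i)
  choose c hc using hdiag
  refine ⟨c, fun x i => ?_⟩
  have hx : φ x i = ∑ j, (LinearMap.proj i ∘ₗ φ ∘ₗ LinearMap.single A S j) (x j) := by
    simp only [LinearMap.comp_apply, LinearMap.proj_apply, ← Finset.sum_apply, ← map_sum]
    exact congrFun (congrArg φ (LinearMap.sum_single_apply S x).symm) i
  rw [hx, Finset.sum_eq_single i (fun j _ hj => by rw [hoff i j hj.symm]; rfl) (by simp), ← hc i]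
  rfl

omit [FiniteDimensional k A] in
theorem exists_smul_eq_of_pairwise_not_equiv [∀ i, FiniteDimensional k (S i)]
    (hsimple : ∀ i, IsSimpleModule A (S i))
    (hpairwise : ∀ i j, i ≠ j → IsEmpty (S i ≃ₗ[A] S j)) (F : Π i, Module.End k (S i)) :
    ∃ a : A, ∀ i (x : S i), a • x = F i x := by
  have hss : IsSemisimpleModule A (Π i, S i) := inferInstance
  let F' : Module.End (Module.End A (Π i, S i)) (Π i, S i) :=
    { toFun := fun x i => F i (x i)
      map_add' := fun x y => by ext i; simp
      map_smul' := fun φ x => by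
        obtain ⟨c, hc⟩ := isScalar_of_pairwise_not_equiv (k := k) hsimple hpairwise φ
        ext i
        simp [hc] }
  classical
  let s : Finset (Π i, S i) := Finset.univ.image
    fun p : (i : Fin N) × Fin (Module.finrank k (S i)) =>
      Pi.single p.1 (Module.finBasis k (S p.1) p.2)
  obtain ⟨a, ha⟩ := jacobson_density F' s
  refine ⟨a, fun i => LinearMap.congr_fun (f := Algebra.lsmul k k (S i) a) ?_⟩
  refine (Module.finBasis k (S i)).ext fun t => ?_
  have := congrFun (ha (Pi.single i (Module.finBasis k (S i) t))
    (Finset.mem_image.2 ⟨⟨i, t⟩, Finset.mem_univ _, rfl⟩)) i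
  simpa [F'] using this.symm

/-- The regular module of a finite-dimensional algebra over an algebraically closed field has
as many indecomposable summands as the sum of the dimensions of the simple modules. -/
theorem indecDecomp_regular_aux (hsimple : ∀ i, IsSimpleModule A (S i))
    (hpairwise : ∀ i j, i ≠ j → IsEmpty (S i ≃ₗ[A] S j))
    (hcomplete : ∀ (T : Type) [AddCommGroup T] [Module A T], IsSimpleModule A T →
      ∃ i, Nonempty (T ≃ₗ[A] S i)) :
    IndecDecomp (⊤ : Submodule A A) (∑ i, Module.finrank k (S i)) := by
  have hfin (i : Fin N) := finiteDimensional_of_isSimpleModule k (hsimple i)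
  let f : A →+* Π i, Module.End k (S i) := RingHom.pi fun i => Module.toModuleEnd k (S i)
  have hfa (a : A) (i : Fin N) (x : S i) : f a i x = a • x := rfl
  have hker : ∀ x ∈ RingHom.ker f, IsNilpotent x := by
    intro x hx
    have hart : IsArtinianRing A := IsArtinianRing.of_finite k A
    obtain ⟨n, hn⟩ := IsArtinianRing.isNilpotent_jacobson_bot (R := A)
    refine ⟨n, ?_⟩
    have hxj : x ∈ Ideal.jacobson (⊥ : Ideal A) := by
      refine Ideal.mem_sInf.2 fun {I} hI => ?_
      have hsI : IsSimpleModule A (A ⧸ I) := isSimpleModule_iff_isCoatom.2 hI.2.1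
      obtain ⟨i, ⟨e⟩⟩ := hcomplete (A ⧸ I) hsI
      have h0 : x • (Submodule.Quotient.mk 1 : A ⧸ I) = 0 := by
        apply e.injective
        rw [map_smul, ← hfa, hx, map_zero]
        rfl
      rw [← Submodule.Quotient.mk_smul, Submodule.Quotient.mk_eq_zero] at h0
      simpa using h0
    have := Ideal.pow_mem_pow hxj n
    rw [hn] at this
    simpa using this
  let P (i : Fin N) (t : Fin (Module.finrank k (S i))) : Module.End k (S i) :=
    ((Module.finBasis k (S i)).coord t).smulRight (Module.finBasis k (S i) t)
  have hP (i t x) : P i t x =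
    (Module.finBasis k (S i)).coord t x • Module.finBasis k (S i) t := rfl
  have hPmul (i t u) : P i t * P i u = if t = u then P i t else 0 := by
    ext x
    split_ifs with h
    · subst h; simp [hP]
    · simp [hP, Ne.symm h]
  let E (p : (i : Fin N) × Fin (Module.finrank k (S i))) : Π i, Module.End k (S i) :=
    Pi.single p.1 (P p.1 p.2)
  have hE : CompleteOrthogonalIdempotents E := by
    refine ⟨⟨?_, ?_⟩, ?_⟩
    · rintro ⟨i, t⟩
      change E ⟨i, t⟩ * E ⟨i, t⟩ = E ⟨i, t⟩
      simp only [E]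
      rw [← Pi.single_mul, hPmul, if_pos rfl]
    · rintro ⟨i, t⟩ ⟨j, u⟩ h
      change E ⟨i, t⟩ * E ⟨j, u⟩ = 0
      simp only [E]
      by_cases hij : i = j
      · subst hij
        rw [← Pi.single_mul, hPmul, if_neg (by simpa using h), Pi.single_zero]
      · ext l : 1
        by_cases hl : l = i
        · subst hl
          simp [hij]
        · simp [hl]
    · rw [Fintype.sum_sigma]
      ext i x
      rw [Finset.sum_apply, Finset.sum_eq_single i]
      · simp only [E, Finset.sum_apply, Pi.single_eq_same, Pi.one_apply, Module.End.one_apply,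
          LinearMap.sum_apply, hP, Module.Basis.coord_apply, Module.Basis.sum_repr]
      · intro j _ hj
        simp [E, hj.symm]
      · simp
  obtain ⟨e, he, hfe⟩ := CompleteOrthogonalIdempotents.lift_of_isNilpotent_ker f hker hE
    (fun p => by
      obtain ⟨a, ha⟩ := exists_smul_eq_of_pairwise_not_equiv hsimple hpairwise (E p)
      exact ⟨a, funext fun i => LinearMap.ext fun x => ha i x⟩)
  have hfe' (p) : f (e p) = E p := congrFun hfe p
  have := he.indecDecomp fun p => ?_
  · simpa using this
  obtain ⟨i, t⟩ := p
  have hfei : f (e ⟨i, t⟩) = Pi.single i (P i t) := hfe' _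
  have hPt : P i t (Module.finBasis k (S i) t) = Module.finBasis k (S i) t := by simp [hP]
  refine isIndec_span_of_idempotent f hker (he.idem _) (fun h0 => ?_) fun x hx hex hxe => ?_
  · rw [h0, map_zero] at hfei
    have := congrFun hfei i
    rw [Pi.single_eq_same] at this
    rw [← this] at hPt
    exact (Module.finBasis k (S i)).ne_zero t hPt.symm
  · have hx1 : f x = Pi.single i (P i t * f x i * P i t) := by
      have h1 : f x = Pi.single i (P i t) * f x * Pi.single i (P i t) := by
        rw [← hfei, ← map_mul, ← map_mul, hex, hxe]
      refine h1.trans ?_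
      ext j : 1
      by_cases hj : j = i
      · subst hj
        simp
      · simp [hj]
    set c : k := (Module.finBasis k (S i)).coord t (f x i (Module.finBasis k (S i) t)) with hc
    have hx2 : P i t * f x i * P i t = c • P i t := by
      ext y
      simp [hP, hc, smul_smul, mul_comm]
    rw [hx2] at hx1
    have hcc : c * c = c := by
      have h2 : f x * f x = f x := by rw [← map_mul, hx.eq]
      rw [hx1, ← Pi.single_mul] at h2
      have h3 := congrArg ((Module.finBasis k (S i)).coord t)
        (LinearMap.congr_fun (Pi.single_injective i h2) (Module.finBasis k (S i) t))
      simpa [hPt] using h3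
    rcases IsIdempotentElem.iff_eq_zero_or_one.1 hcc with h0 | h1
    · left; rw [hx1, h0, zero_smul, Pi.single_zero]
    · right; rw [hx1, h1, one_smul, hfei]

theorem indecDecomp_regular {k A : Type} [Field k] [IsAlgClosed k] [Ring A] [Algebra k A]
    [FiniteDimensional k A] {N : ℕ} (S : Fin N → Type) [∀ i, AddCommGroup (S i)]
    [∀ i, Module A (S i)] (hsimple : ∀ i, IsSimpleModule A (S i))
    (hpairwise : ∀ i j, i ≠ j → IsEmpty (S i ≃ₗ[A] S j))
    (hcomplete : ∀ (T : Type) [AddCommGroup T] [Module A T], IsSimpleModule A T →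
      ∃ i, Nonempty (T ≃ₗ[A] S i)) :
    IndecDecomp (⊤ : Submodule A A) (∑ i, Module.finrank k (RestrictScalars k A (S i))) :=
  @indecDecomp_regular_aux k A _ _ _ _ _ N (fun i => RestrictScalars k A (S i)) _
    (fun i => RestrictScalars.moduleOrig k A (S i)) (fun i => RestrictScalars.module k A (S i))
    (fun i => RestrictScalars.isScalarTower k A (S i)) hsimple hpairwise hcomplete

end RegularModule

section RegularSplitting

/-- A multiplicity space `E` of a copy of the regular representation of `G`, killed by everything
outside of `G`, that splits off a representation of a monoid containing `G`. -/
structure RegularSplitting {k G M U : Type*} [Field k] [Group G] [Monoid M] [AddCommGroup U]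
    [Module k U] (j : G →* M) (ρ : Representation k M U) (E : Type*) [AddCommGroup E]
    [Module k E] where
  incl : E →ₗ[k] U
  proj : U →ₗ[k] E
  map_incl : ∀ x ∉ Set.range j, ∀ e, ρ x (incl e) = 0
  proj_map : ∀ x ∉ Set.range j, ∀ v, proj (ρ x v) = 0
  proj_incl : ∀ e, proj (incl e) = e
  proj_map_incl : ∀ g ≠ 1, ∀ e, proj (ρ (j g) (incl e)) = 0

namespace RegularSplitting

variable {k G M U U' E E' : Type*} [Field k] [Group G] [Fintype G] [Monoid M]
  [AddCommGroup U] [Module k U] [AddCommGroup U'] [Module k U']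
  [AddCommGroup E] [Module k E] [AddCommGroup E'] [Module k E'] {j : G →* M}
  {ρ : Representation k M U} {ρ' : Representation k M U'}

/-- The embedding of the copies of the regular representation. -/
def combine (s : RegularSplitting j ρ E) : (G → E) →ₗ[k] U :=
  ∑ g, ρ (j g) ∘ₗ s.incl ∘ₗ LinearMap.proj g

omit [Fintype G] in
/-- The projection to the copies of the regular representation. -/
def coeffs (s : RegularSplitting j ρ E) : U →ₗ[k] (G → E) :=
  LinearMap.pi fun g => s.proj ∘ₗ ρ (j g⁻¹)

theorem combine_apply (s : RegularSplitting j ρ E) (y : G → E) :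
    s.combine y = ∑ g, ρ (j g) (s.incl (y g)) := by
  simp [combine, LinearMap.sum_apply]

omit [Fintype G] in
theorem coeffs_apply (s : RegularSplitting j ρ E) (w : U) (g : G) :
    s.coeffs w g = s.proj (ρ (j g⁻¹) w) := rfl

theorem coeffs_combine (s : RegularSplitting j ρ E) (y : G → E) : s.coeffs (s.combine y) = y := by
  ext g
  simp only [coeffs_apply, combine_apply, map_sum, ← Module.End.mul_apply, ← map_mul]
  rw [Finset.sum_eq_single g]
  · simp [s.proj_incl]
  · intro h _ hg
    exact s.proj_map_incl _ (fun h' => hg (inv_mul_eq_one.1 h').symm) _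
  · simp

theorem map_combine (s : RegularSplitting j ρ E) (h : G) (y : G → E) :
    ρ (j h) (s.combine y) = s.combine fun g => y (h⁻¹ * g) := by
  simp only [combine_apply, map_sum, ← Module.End.mul_apply, ← map_mul]
  exact Fintype.sum_equiv (Equiv.mulLeft h) _ _ (by simp)

theorem map_combine_of_notMem (s : RegularSplitting j ρ E) {x : M} (hx : x ∉ Set.range j)
    (y : G → E) : ρ x (s.combine y) = 0 := by
  simp only [combine_apply, map_sum, ← Module.End.mul_apply, ← map_mul]
  refine Finset.sum_eq_zero fun g _ => s.map_incl _ ?_ _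
  rintro ⟨h, hh⟩
  exact hx ⟨h * g⁻¹, by rw [map_mul, hh, mul_assoc, ← map_mul, mul_inv_cancel, map_one, mul_one]⟩

omit [Fintype G] in
theorem map_mem_ker_coeffs (s : RegularSplitting j ρ E) (x : M) {w : U}
    (hw : w ∈ LinearMap.ker s.coeffs) : ρ x w ∈ LinearMap.ker s.coeffs := by
  rw [LinearMap.mem_ker] at hw ⊢
  ext g
  rw [coeffs_apply, ← Module.End.mul_apply, ← map_mul]
  by_cases hx : x ∈ Set.range j
  · obtain ⟨h, rfl⟩ := hx
    have := congrFun hw (h⁻¹ * g)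
    rwa [coeffs_apply, mul_inv_rev, inv_inv, map_mul] at this
  · refine s.proj_map _ ?_ _
    rintro ⟨h, hh⟩
    exact hx ⟨g * h, by rw [map_mul, hh, ← mul_assoc, ← map_mul, mul_inv_cancel, map_one, one_mul]⟩

theorem isCompl (s : RegularSplitting j ρ E) :
    IsCompl (LinearMap.range s.combine) (LinearMap.ker s.coeffs) := by
  constructor
  · rw [Submodule.disjoint_def]
    rintro _ ⟨y, rfl⟩ h
    rw [LinearMap.mem_ker, coeffs_combine] at h
    rw [h, map_zero]
  · rw [codisjoint_iff, eq_top_iff]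
    intro w _
    refine Submodule.mem_sup.2 ⟨s.combine (s.coeffs w), ⟨_, rfl⟩, w - s.combine (s.coeffs w), ?_,
      add_sub_cancel _ _⟩
    simp [coeffs_combine]

theorem finrank_ker_coeffs [FiniteDimensional k U] [FiniteDimensional k E]
    (s : RegularSplitting j ρ E) :
    Module.finrank k U =
      Fintype.card G * Module.finrank k E + Module.finrank k (LinearMap.ker s.coeffs) := by
  rw [← LinearMap.finrank_range_add_finrank_ker s.coeffs,
    LinearMap.range_eq_top.2 fun y => ⟨_, s.coeffs_combine y⟩, finrank_top,
    Module.finrank_pi_fintype, Finset.sum_const, smul_eq_mul, Finset.card_univ]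

/-- The projection to the complement. -/
def toKer (s : RegularSplitting j ρ E) : U →ₗ[k] LinearMap.ker s.coeffs :=
  (LinearMap.id - s.combine ∘ₗ s.coeffs).codRestrict _ fun w => by
    simp [coeffs_combine]

theorem toKer_of_mem (s : RegularSplitting j ρ E) (w : LinearMap.ker s.coeffs) :
    s.toKer w = w := by
  ext
  simp [toKer]

theorem toKer_map_incl (s : RegularSplitting j ρ E) (g : G) (e : E) :
    s.toKer (ρ (j g) (s.incl e)) = 0 := by
  classical
  have : ρ (j g) (s.incl e) = s.combine (Pi.single g e) := by
    rw [combine_apply, Finset.sum_eq_single g] <;> simp +contextual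
  rw [this]
  ext
  simp [toKer, coeffs_combine]

omit [Fintype G] in
theorem proj_map_of_mem_ker (s : RegularSplitting j ρ E) (g : G) (w : LinearMap.ker s.coeffs) :
    s.proj (ρ (j g) w) = 0 := by
  have := congrFun (LinearMap.mem_ker.1 w.2) g⁻¹
  rwa [coeffs_apply, inv_inv] at this

/-- Replacing the multiplicity space by an isomorphic one. -/
def congr (s : RegularSplitting j ρ E) (e : E ≃ₗ[k] E') : RegularSplitting j ρ E' where
  incl := s.incl ∘ₗ e.symm
  proj := e ∘ₗ s.proj
  map_incl x hx _ := s.map_incl x hx _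
  proj_map x hx v := by simp [s.proj_map x hx v]
  proj_incl _ := by simp [s.proj_incl]
  proj_map_incl g hg _ := by simp [s.proj_map_incl g hg]

omit [Fintype G] in
/-- Transport along an isomorphism of representations. -/
def ofEquiv (s : RegularSplitting j ρ E) (φ : U ≃ₗ[k] U') (h : ∀ x v, φ (ρ x v) = ρ' x (φ v)) :
    RegularSplitting j ρ' E where
  incl := φ ∘ₗ s.incl
  proj := s.proj ∘ₗ φ.symm
  map_incl x hx e := by simp [← h, s.map_incl x hx]
  proj_map x hx v := by
    obtain ⟨v, rfl⟩ := φ.surjective v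
    simp [← h, s.proj_map x hx]
  proj_incl _ := by simp [s.proj_incl]
  proj_map_incl g hg _ := by simp [← h, s.proj_map_incl g hg]

/-- The embedding of the multiplicity space of a tensor product. -/
def tprodIncl (s : RegularSplitting j ρ E) (s' : RegularSplitting j ρ' E') :
    (E ⊗[k] U') × (LinearMap.ker s.coeffs ⊗[k] E') →ₗ[k] U ⊗[k] U' :=
  (TensorProduct.map s.incl LinearMap.id).coprod
    (TensorProduct.map (Submodule.subtype _) s'.incl)

/-- The projection to the multiplicity space of a tensor product. -/
def tprodProj (s : RegularSplitting j ρ E) (s' : RegularSplitting j ρ' E') :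
    U ⊗[k] U' →ₗ[k] (E ⊗[k] U') × (LinearMap.ker s.coeffs ⊗[k] E') :=
  (TensorProduct.map s.proj LinearMap.id).prod (TensorProduct.map s.toKer s'.proj)

/-- The splitting of a tensor product. -/
def tprod (s : RegularSplitting j ρ E) (s' : RegularSplitting j ρ' E') :
    RegularSplitting j (ρ.tprod ρ') ((E ⊗[k] U') × (LinearMap.ker s.coeffs ⊗[k] E')) where
  incl := s.tprodIncl s'
  proj := s.tprodProj s'
  map_incl x hx := LinearMap.congr_fun (f := ρ.tprod ρ' x ∘ₗ s.tprodIncl s') (g := 0) <| by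
    ext e u <;> simp [tprodIncl, s.map_incl x hx, s'.map_incl x hx]
  proj_map x hx := LinearMap.congr_fun (f := s.tprodProj s' ∘ₗ ρ.tprod ρ' x) (g := 0) <| by
    ext e u <;> simp [tprodProj, s.proj_map x hx, s'.proj_map x hx]
  proj_incl := LinearMap.congr_fun (f := s.tprodProj s' ∘ₗ s.tprodIncl s') (g := LinearMap.id) <| by
    have h1 (e : E) := s.toKer_map_incl 1 e
    have h2 (w : LinearMap.ker s.coeffs) := s.proj_map_of_mem_ker 1 w
    simp only [map_one, Module.End.one_apply] at h1 h2
    ext e u <;>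
      simp [tprodIncl, tprodProj, s.proj_incl, s'.proj_incl, h1, h2, s.toKer_of_mem]
  proj_map_incl g hg := LinearMap.congr_fun
      (f := s.tprodProj s' ∘ₗ ρ.tprod ρ' (j g) ∘ₗ s.tprodIncl s') (g := 0) <| by
    ext e u <;> simp [tprodIncl, tprodProj, s.proj_map_incl g hg, s'.proj_map_incl g hg,
      s.toKer_map_incl, s.proj_map_of_mem_ker]

end RegularSplitting

/-- The representation splits off copies of the regular representation of `G`, with a complement
of dimension `D`. -/
def HasRegularDefect {k G M U : Type*} [Field k] [Group G] [Fintype G] [Monoid M] [AddCommGroup U]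
    [Module k U] (j : G →* M) (ρ : Representation k M U) (D : ℕ) : Prop :=
  ∃ f : ℕ, Module.finrank k U = Fintype.card G * f + D ∧
    Nonempty (RegularSplitting j ρ (Fin f → k))

namespace HasRegularDefect

variable {k G M U U' E : Type*} [Field k] [Group G] [Fintype G] [Monoid M]
  [AddCommGroup U] [Module k U] [AddCommGroup U'] [Module k U']
  [AddCommGroup E] [Module k E] {j : G →* M}
  {ρ : Representation k M U} {ρ' : Representation k M U'} {D D' : ℕ}

theorem of_splitting [FiniteDimensional k E] (s : RegularSplitting j ρ E)
    (h : Module.finrank k U = Fintype.card G * Module.finrank k E + D) : HasRegularDefect j ρ D :=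
  ⟨_, h, ⟨s.congr (LinearEquiv.ofFinrankEq _ _ (by simp))⟩⟩

theorem finrank_self (j : G →* M) (ρ : Representation k M U) :
    HasRegularDefect j ρ (Module.finrank k U) :=
  ⟨0, by simp, ⟨{
    incl := 0
    proj := 0
    map_incl := by simp
    proj_map := by simp
    proj_incl := fun _ => Subsingleton.elim _ _
    proj_map_incl := by simp }⟩⟩

theorem ofEquiv (h : HasRegularDefect j ρ D) (φ : U ≃ₗ[k] U')
    (hφ : ∀ x v, φ (ρ x v) = ρ' x (φ v)) : HasRegularDefect j ρ' D := by
  obtain ⟨f, hf, ⟨s⟩⟩ := h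
  exact ⟨f, φ.finrank_eq ▸ hf, ⟨s.ofEquiv φ hφ⟩⟩

theorem tprod [FiniteDimensional k U] [FiniteDimensional k U'] (h : HasRegularDefect j ρ D)
    (h' : HasRegularDefect j ρ' D') : HasRegularDefect j (ρ.tprod ρ') (D * D') := by
  obtain ⟨f, hf, ⟨s⟩⟩ := h
  obtain ⟨f', hf', ⟨s'⟩⟩ := h'
  refine of_splitting (s.tprod s') ?_
  have hD := s.finrank_ker_coeffs
  rw [hf, Module.finrank_fin_fun, Nat.add_left_cancel_iff] at hD
  rw [Module.finrank_prod, Module.finrank_tensorProduct, Module.finrank_tensorProduct,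
    Module.finrank_tensorProduct, ← hD, Module.finrank_fin_fun, Module.finrank_fin_fun, hf, hf']
  ring

end HasRegularDefect

end RegularSplitting

section TensorPower

theorem exists_dual_apply_eq_one_apply_map_eq_zero {k V : Type*} [Field k] [AddCommGroup V]
    [Module k V] [Nontrivial V] {f : Module.End k V} (hf : ∀ c : k, c ≠ 0 → f ≠ c • 1) :
    ∃ (v : V) (φ : V →ₗ[k] k), φ v = 1 ∧ φ (f v) = 0 := by
  suffices h : ∃ v, v ∉ Submodule.span k {f v} by
    obtain ⟨v, hv⟩ := h
    obtain ⟨φ, hφ, hφ'⟩ := Submodule.exists_le_ker_of_notMem hv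
    refine ⟨v, (φ v)⁻¹ • φ, by simp [hφ], ?_⟩
    have := hφ' (Submodule.mem_span_singleton_self (f v))
    simp [LinearMap.mem_ker.1 this]
  by_contra! h
  obtain ⟨c, rfl⟩ := LinearMap.exists_eq_smul_id_of_forall_notLinearIndependent (f := f)
    fun v hv => by
      obtain ⟨a, ha⟩ := Submodule.mem_span_singleton.1 (h v)
      have := (LinearIndependent.pair_iff.1 hv 1 (-a) (by simp [ha])).1
      exact one_ne_zero this
  by_cases hc : c = 0
  · obtain ⟨v, hv⟩ := exists_ne (0 : V)
    have := h v
    simp [hc, hv] at this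
  · exact hf c hc rfl

theorem finrank_tensorPower (k V : Type*) [Field k] [AddCommGroup V] [Module k V]
    [FiniteDimensional k V] (n : ℕ) :
    Module.finrank k (⨂[k]^n V) = Module.finrank k V ^ n := by
  rw [Module.finrank_eq_card_basis (Basis.piTensorProduct fun _ : Fin n => Module.finBasis k V)]
  simp

variable {k M V : Type*} [Field k] [Monoid M] [AddCommGroup V] [Module k V]

theorem Representation.tensorPower_tprod (ρ : Representation k M V) (n : ℕ) (x : M)
    (v : Fin n → V) : ρ.tensorPower n x (PiTensorProduct.tprod k v) =
      PiTensorProduct.tprod k fun i => ρ x (v i) :=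
  PiTensorProduct.map_tprod _ _

theorem mulEquiv_tensorPower (ρ : Representation k M V) (n p : ℕ) (x : M)
    (w : (⨂[k]^n V) ⊗[k] (⨂[k]^p V)) :
    TensorPower.mulEquiv (((ρ.tensorPower n).tprod (ρ.tensorPower p)) x w) =
      ρ.tensorPower (n + p) x (TensorPower.mulEquiv w) := by
  refine LinearMap.congr_fun (f := TensorPower.mulEquiv.toLinearMap ∘ₗ
    ((ρ.tensorPower n).tprod (ρ.tensorPower p)) x)
    (g := ρ.tensorPower (n + p) x ∘ₗ TensorPower.mulEquiv.toLinearMap) ?_ w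
  have hmul {q r : ℕ} (a : Fin q → V) (b : Fin r → V) :
      TensorPower.mulEquiv (PiTensorProduct.tprod k a ⊗ₜ[k] PiTensorProduct.tprod k b) =
        PiTensorProduct.tprod k (Fin.append a b) := by
    rw [← TensorPower.tprod_mul_tprod, TensorPower.gMul_def]
  refine TensorProduct.ext (PiTensorProduct.ext (MultilinearMap.ext fun a =>
    PiTensorProduct.ext (MultilinearMap.ext fun b => ?_)))
  change TensorPower.mulEquiv (ρ.tensorPower n x (PiTensorProduct.tprod k a) ⊗ₜ[k]
      ρ.tensorPower p x (PiTensorProduct.tprod k b)) = ρ.tensorPower (n + p) x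
      (TensorPower.mulEquiv (PiTensorProduct.tprod k a ⊗ₜ[k] PiTensorProduct.tprod k b))
  rw [hmul, Representation.tensorPower_tprod, Representation.tensorPower_tprod,
    Representation.tensorPower_tprod, hmul]
  congr 1
  ext i
  refine Fin.addCases (fun i => ?_) (fun i => ?_) i <;> simp

theorem HasRegularDefect.tensorPower_add {G : Type*} [Group G] [Fintype G] {j : G →* M}
    [FiniteDimensional k V] {ρ : Representation k M V} {n p D D' : ℕ}
    (h : HasRegularDefect j (ρ.tensorPower n) D) (h' : HasRegularDefect j (ρ.tensorPower p) D') :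
    HasRegularDefect j (ρ.tensorPower (n + p)) (D * D') :=
  (h.tprod h').ofEquiv TensorPower.mulEquiv (mulEquiv_tensorPower ρ n p)

theorem HasRegularDefect.tensorPower_add_mul {G : Type*} [Group G] [Fintype G] {j : G →* M}
    [FiniteDimensional k V] {ρ : Representation k M V} {p q : ℕ}
    (h : HasRegularDefect j (ρ.tensorPower p) q) (r i : ℕ) :
    HasRegularDefect j (ρ.tensorPower (r + i * p)) (Module.finrank k V ^ r * q ^ i) := by
  induction i with
  | zero =>
    have := HasRegularDefect.finrank_self j (ρ.tensorPower r)
    rw [finrank_tensorPower] at this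
    rwa [zero_mul, add_zero, pow_zero, mul_one]
  | succ i ih =>
    have := ih.tensorPower_add h
    rwa [mul_assoc, ← pow_succ, add_assoc, ← Nat.succ_mul] at this

theorem exists_tensorPower_separating [Fintype M] [Nontrivial V] (ρ : Representation k M V)
    (hρ : ∀ (x : M) (c : k), c ≠ 0 → ρ x = c • 1 → x = 1) :
    ∃ (w : ⨂[k]^(Fintype.card M) V) (μ : ⨂[k]^(Fintype.card M) V →ₗ[k] k),
      μ w = 1 ∧ ∀ x ≠ 1, μ (ρ.tensorPower _ x w) = 0 := by
  have h (x : M) : ∃ (v : V) (φ : V →ₗ[k] k), φ v = 1 ∧ (x ≠ 1 → φ (ρ x v) = 0) := by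
    by_cases hx : x = 1
    · obtain ⟨v, hv⟩ := exists_ne (0 : V)
      obtain ⟨φ, hφ⟩ := Module.Projective.exists_dual_ne_zero k hv
      exact ⟨v, (φ v)⁻¹ • φ, by simp [hφ], fun h => (h hx).elim⟩
    · obtain ⟨v, φ, h1, h2⟩ := exists_dual_apply_eq_one_apply_map_eq_zero
        fun c hc h => hx (hρ x c hc h)
      exact ⟨v, φ, h1, fun _ => h2⟩
  choose v φ h1 h0 using h
  let e := (Fintype.equivFin M).symm
  refine ⟨PiTensorProduct.tprod k fun i => v (e i),
    PiTensorProduct.dualDistrib (PiTensorProduct.tprod k fun i => φ (e i)), ?_, fun x hx => ?_⟩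
  · simp [h1]
  · rw [Representation.tensorPower_tprod, PiTensorProduct.dualDistrib_apply]
    refine Finset.prod_eq_zero (Finset.mem_univ (e.symm x)) ?_
    rw [e.apply_symm_apply, h0 x hx]

end TensorPower

namespace RookMonoid

variable {m : ℕ}

theorem mul_apply (x y : RookMonoid m) (a : Fin (m + 1)) : (x * y).1 a = x.1 (y.1 a) := rfl

theorem one_apply (a : Fin (m + 1)) : (1 : RookMonoid m).1 a = a := rfl

theorem apply_zero (x : RookMonoid m) : x.1 0 = 0 := x.2.1

theorem ext_succ {x y : RookMonoid m} (h : ∀ i : Fin m, x.1 i.succ = y.1 i.succ) : x = y :=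
  Subtype.ext <| funext <| Fin.cases (by rw [apply_zero, apply_zero]) h

instance : Finite (RookMonoid m) :=
  Finite.of_injective (β := Fin (m + 1) → Fin (m + 1)) (fun x => x.1) Subtype.val_injective

/-- The inclusion of the symmetric group. -/
def ofPerm : Equiv.Perm (Fin m) →* RookMonoid m where
  toFun g := ⟨Fin.cons (α := fun _ => Fin (m + 1)) 0 fun i => (g i).succ, by
    refine ⟨rfl, fun a b => ?_⟩
    refine Fin.cases (by simp) (fun a => ?_) a
    refine Fin.cases (by simp) (fun b => ?_) b
    simp⟩
  map_one' := ext_succ fun _ => rfl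
  map_mul' _ _ := ext_succ fun _ => rfl

theorem ofPerm_succ (g : Equiv.Perm (Fin m)) (i : Fin m) : (ofPerm g).1 i.succ = (g i).succ := rfl

theorem ofPerm_injective : Function.Injective (ofPerm (m := m)) := by
  intro g h hgh
  ext1 i
  rw [← Fin.succ_inj, ← ofPerm_succ, ← ofPerm_succ, hgh]

/-- The partial identity that is undefined on `S`. -/
def idem (S : Finset (Fin m)) : RookMonoid m :=
  ⟨Fin.cons (α := fun _ => Fin (m + 1)) 0 fun i => if i ∈ S then 0 else i.succ, by
    refine ⟨rfl, fun a b => ?_⟩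
    refine Fin.cases (by simp) (fun a => ?_) a
    refine Fin.cases (by simp) (fun b => ?_) b
    simp only [Fin.cons_succ]
    split_ifs <;> simp⟩

theorem idem_succ (S : Finset (Fin m)) (i : Fin m) :
    (idem S).1 i.succ = if i ∈ S then 0 else i.succ := rfl

theorem idem_empty : idem (∅ : Finset (Fin m)) = 1 :=
  ext_succ fun i => by simp [idem_succ, one_apply]

theorem mem_range_ofPerm_of_injective {x : RookMonoid m} (hx : Function.Injective x.1) :
    x ∈ Set.range ofPerm := by
  have h0 (i : Fin m) : x.1 i.succ ≠ 0 := fun h =>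
    Fin.succ_ne_zero i (hx (h.trans (apply_zero x).symm))
  let f (i : Fin m) : Fin m := (x.1 i.succ).pred (h0 i)
  have hf : Function.Injective f := fun a b h => by
    simpa using hx (Fin.pred_inj.1 h)
  refine ⟨Equiv.ofBijective f (Finite.injective_iff_bijective.1 hf), ext_succ fun i => ?_⟩
  simp [ofPerm_succ, f]

theorem exists_apply_succ_eq_zero {x : RookMonoid m} (hx : x ∉ Set.range ofPerm) :
    ∃ i : Fin m, x.1 i.succ = 0 := by
  by_contra! h
  refine hx (mem_range_ofPerm_of_injective fun a b hab => ?_)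
  by_cases ha : x.1 a = 0
  · have h0 (a : Fin (m + 1)) (ha : x.1 a = 0) : a = 0 := by
      revert ha
      exact Fin.cases (fun _ => rfl) (fun i hi => (h i hi).elim) a
    rw [h0 a ha, h0 b (hab ▸ ha)]
  · exact x.2.2 a b hab ha

theorem exists_succ_notMem_range {x : RookMonoid m} (hx : x ∉ Set.range ofPerm) :
    ∃ i : Fin m, ∀ a, x.1 a ≠ i.succ := by
  by_contra! h
  refine hx (mem_range_ofPerm_of_injective (Finite.injective_iff_surjective.2 fun a => ?_))
  exact Fin.cases ⟨0, (apply_zero x)⟩ h a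

theorem ofPerm_mul_idem (g : Equiv.Perm (Fin m)) (S : Finset (Fin m)) :
    ofPerm g * idem S = idem (S.map g.toEmbedding) * ofPerm g := by
  refine ext_succ fun i => ?_
  rw [mul_apply, mul_apply, ofPerm_succ, idem_succ, idem_succ]
  simp only [Finset.mem_map_equiv, Equiv.symm_apply_apply]
  split_ifs
  · exact apply_zero _
  · rfl

theorem mul_idem_symmDiff {x : RookMonoid m} {i : Fin m} (hi : x.1 i.succ = 0)
    (S : Finset (Fin m)) : x * idem (symmDiff S {i}) = x * idem S := by
  refine ext_succ fun a => ?_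
  rw [mul_apply, mul_apply, idem_succ, idem_succ]
  by_cases ha : a = i
  · subst ha
    split_ifs <;> simp [hi, apply_zero]
  · simp [Finset.mem_symmDiff, ha]

theorem idem_symmDiff_mul {x : RookMonoid m} {i : Fin m} (hi : ∀ a, x.1 a ≠ i.succ)
    (S : Finset (Fin m)) : idem (symmDiff S {i}) * x = idem S * x := by
  refine ext_succ fun a => ?_
  rw [mul_apply, mul_apply]
  have := hi a.succ
  revert this
  refine Fin.cases (fun _ => by rw [apply_zero, apply_zero]) (fun b hb => ?_) (x.1 a.succ)
  rw [idem_succ, idem_succ]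
  have hb' : b ≠ i := fun h => hb (h ▸ rfl)
  simp [Finset.mem_symmDiff, hb']

theorem idem_mul_of_notMem_range {x : RookMonoid m} {i : Fin m} (hi : ∀ a, x.1 a ≠ i.succ) :
    idem {i} * x = x := by
  have := idem_symmDiff_mul hi ∅
  rwa [idem_empty, one_mul, ← Finset.bot_eq_empty, bot_symmDiff] at this

theorem ofPerm_mul_idem_ne_one {g : Equiv.Perm (Fin m)} {S : Finset (Fin m)} (hS : S ≠ ∅) :
    ofPerm g * idem S ≠ 1 := by
  obtain ⟨i, hi⟩ := Finset.nonempty_iff_ne_empty.2 hS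
  intro h
  have := congrArg (fun x : RookMonoid m => x.1 i.succ) h
  simp only [mul_apply, idem_succ, if_pos hi, apply_zero, one_apply] at this
  exact Fin.succ_ne_zero i this.symm

theorem idem_notMem_range {S : Finset (Fin m)} (hS : S ≠ ∅) : idem S ∉ Set.range ofPerm := by
  rintro ⟨g, hg⟩
  refine ofPerm_mul_idem_ne_one (g := g⁻¹) hS ?_
  rw [← hg, ← map_mul, inv_mul_cancel, map_one]

theorem sum_neg_one_pow_card_smul_eq_zero {U : Type*} [AddCommGroup U] (F : Finset (Fin m) → U)
    (i : Fin m) (hF : ∀ S, F (symmDiff S {i}) = F S) :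
    ∑ S : Finset (Fin m), (-1 : ℤ) ^ S.card • F S = 0 := by
  refine Finset.sum_involution (fun S _ => symmDiff S {i}) (fun S _ => ?_) (fun S _ _ h => ?_)
    (fun S _ => Finset.mem_univ _) (fun S _ => symmDiff_symmDiff_cancel_right _ _)
  · have hcard : (-1 : ℤ) ^ (symmDiff S {i}).card = -(-1) ^ S.card := by
      by_cases hi : i ∈ S
      · have : symmDiff S {i} = S.erase i := by
          ext a
          by_cases ha : a = i <;> simp [Finset.mem_symmDiff, ha, hi]
        rw [this, ← Finset.card_erase_add_one hi, pow_succ]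
        simp
      · have : symmDiff S {i} = insert i S := by
          ext a
          by_cases ha : a = i <;> simp [Finset.mem_symmDiff, ha, hi]
        rw [this, Finset.card_insert_of_notMem hi, pow_succ]
        simp
    rw [hF, hcard, neg_smul, add_neg_cancel]
  · have : i ∈ symmDiff S {i} ↔ i ∈ S := by rw [h]
    simp [Finset.mem_symmDiff] at this

variable {k U : Type*} [Field k] [AddCommGroup U] [Module k U]
  (σ : Representation k (RookMonoid m) U)

/-- The projection to the part killed by all rook matrices that are not permutations. -/
def unitProj : Module.End k U :=
  ∑ S : Finset (Fin m), (-1 : ℤ) ^ S.card • σ (idem S)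

theorem map_mul_unitProj {x : RookMonoid m} (hx : x ∉ Set.range ofPerm) :
    σ x * unitProj σ = 0 := by
  obtain ⟨i, hi⟩ := exists_apply_succ_eq_zero hx
  simp only [unitProj, Finset.mul_sum, mul_smul_comm, ← map_mul]
  exact sum_neg_one_pow_card_smul_eq_zero _ i fun S => by rw [mul_idem_symmDiff hi]

theorem unitProj_mul_map {x : RookMonoid m} (hx : x ∉ Set.range ofPerm) :
    unitProj σ * σ x = 0 := by
  obtain ⟨i, hi⟩ := exists_succ_notMem_range hx
  simp only [unitProj, Finset.sum_mul, smul_mul_assoc, ← map_mul]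
  exact sum_neg_one_pow_card_smul_eq_zero _ i fun S => by rw [idem_symmDiff_mul hi]

theorem map_ofPerm_mul_unitProj (g : Equiv.Perm (Fin m)) :
    σ (ofPerm g) * unitProj σ = unitProj σ * σ (ofPerm g) := by
  simp only [unitProj, Finset.mul_sum, Finset.sum_mul, mul_smul_comm, smul_mul_assoc, ← map_mul]
  exact Fintype.sum_equiv g.finsetCongr _ _ fun S => by simp [ofPerm_mul_idem]

theorem unitProj_mul_self : unitProj σ * unitProj σ = unitProj σ := by
  nth_rw 2 [unitProj]
  simp only [Finset.mul_sum, mul_smul_comm]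
  rw [Finset.sum_eq_single ∅]
  · simp [idem_empty]
  · intro S _ hS
    rw [unitProj_mul_map σ (idem_notMem_range hS), smul_zero]
  · simp

theorem exists_hasRegularDefect_of_separating [FiniteDimensional k U] {w : U}
    {μ : U →ₗ[k] k} (h1 : μ w = 1)
    (h0 : ∀ x ≠ 1, μ (σ x w) = 0) :
    ∃ D, Module.finrank k U = m.factorial + D ∧ HasRegularDefect (ofPerm (m := m)) σ D := by
  have key (g : Equiv.Perm (Fin m)) :
      μ (unitProj σ (σ (ofPerm g) (unitProj σ w))) = μ (σ (ofPerm g) w) := by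
    simp only [← Module.End.mul_apply]
    rw [map_ofPerm_mul_unitProj, ← mul_assoc, unitProj_mul_self, ← map_ofPerm_mul_unitProj]
    simp only [unitProj, Finset.mul_sum, mul_smul_comm, ← map_mul, LinearMap.sum_apply, map_sum,
      LinearMap.smul_apply, map_zsmul]
    rw [Finset.sum_eq_single ∅]
    · simp [idem_empty]
    · intro S _ hS
      rw [h0 _ (ofPerm_mul_idem_ne_one hS), smul_zero]
    · simp
  let s : RegularSplitting (ofPerm (m := m)) σ k :=
    { incl := LinearMap.toSpanSingleton k U (unitProj σ w)
      proj := μ ∘ₗ unitProj σ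
      map_incl x hx e := by
        have := LinearMap.congr_fun (map_mul_unitProj σ hx) w
        rw [Module.End.mul_apply] at this
        simp [this]
      proj_map x hx v := by
        have := LinearMap.congr_fun (unitProj_mul_map σ hx) v
        rw [Module.End.mul_apply] at this
        simp [this]
      proj_incl e := by
        have := key 1
        rw [map_one, map_one, Module.End.one_apply, Module.End.one_apply, h1] at this
        simp [this]
      proj_map_incl g hg e := by
        have := key g
        rw [h0 _ fun h => hg (ofPerm_injective (by rw [h, map_one]))] at this
        simp [this] }
  have hs := s.finrank_ker_coeffs
  refine ⟨_, ?_, HasRegularDefect.of_splitting s hs⟩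
  rw [hs, Module.finrank_self, mul_one, Fintype.card_perm, Fintype.card_fin]

theorem mem_range_ofPerm_of_map_eq_smul_one {σ : Representation k (RookMonoid m) U}
    (hσ : ∀ x, σ x = 1 → x = 1) {x : RookMonoid m} {c : k} (hc : c ≠ 0)
    (hx : σ x = c • (1 : Module.End k U)) : x ∈ Set.range ofPerm := by
  by_contra h
  obtain ⟨i, hi⟩ := exists_succ_notMem_range h
  refine idem_notMem_range (S := {i}) (Finset.singleton_ne_empty i) ⟨1, ?_⟩
  rw [map_one, hσ (idem {i})]
  have := congrArg σ (idem_mul_of_notMem_range hi)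
  rw [map_mul, hx, mul_smul_comm, mul_one] at this
  exact smul_right_injective _ hc this

theorem commute_of_map_ofPerm_eq_smul_one {σ : Representation k (RookMonoid m) U}
    (hσ : ∀ x, σ x = 1 → x = 1) {g : Equiv.Perm (Fin m)} {c : k}
    (hg : σ (ofPerm g) = c • (1 : Module.End k U)) (h : Equiv.Perm (Fin m)) : Commute g h := by
  have key : σ (ofPerm (g * h)) = σ (ofPerm (h * g)) := by
    rw [map_mul, map_mul, map_mul, map_mul, hg, smul_mul_assoc, mul_smul_comm, one_mul, mul_one]
  have h1 : σ (ofPerm ((h * g)⁻¹ * (g * h))) = 1 := by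
    rw [map_mul, map_mul, key, ← map_mul, ← map_mul, inv_mul_cancel, map_one, map_one]
  have h2 := ofPerm_injective ((hσ _ h1).trans (map_one _).symm)
  exact (inv_mul_eq_one.1 h2).symm

theorem _root_.Equiv.Perm.eq_one_of_commute {α : Type*} [DecidableEq α] [Finite α]
    (hα : Nat.card α ≠ 2) {g : Equiv.Perm α} (hg : ∀ h, Commute g h) : g = 1 := by
  by_contra h1
  obtain ⟨a, ha⟩ : ∃ a, g a ≠ a := by
    by_contra! h
    exact h1 (Equiv.ext h)
  by_cases hb : ∃ b, b ≠ a ∧ b ≠ g a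
  · obtain ⟨b, hba, hbg⟩ := hb
    have := congrArg (fun f : Equiv.Perm α => f a) (hg (Equiv.swap (g a) b)).eq
    simp only [Equiv.Perm.mul_apply, Equiv.swap_apply_left] at this
    rw [Equiv.swap_apply_of_ne_of_ne ha.symm hba.symm] at this
    exact hbg this.symm
  · push Not at hb
    refine hα (Nat.card_eq_two_iff.2 ⟨a, g a, ha.symm, ?_⟩)
    refine Set.eq_univ_of_forall fun b => ?_
    by_cases hba : b = a
    · exact Or.inl hba
    · exact Or.inr (hb b hba)

theorem eq_one_of_map_eq_smul_one {σ : Representation k (RookMonoid m) U}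
    (hσ : ∀ x, σ x = 1 → x = 1) (hm : m ≠ 2) {x : RookMonoid m} {c : k} (hc : c ≠ 0)
    (hx : σ x = c • (1 : Module.End k U)) : x = 1 := by
  obtain ⟨g, rfl⟩ := mem_range_ofPerm_of_map_eq_smul_one hσ hc hx
  rw [Equiv.Perm.eq_one_of_commute (by simpa using hm)
    (commute_of_map_ofPerm_eq_smul_one hσ hx), map_one]

end RookMonoid

section SummandCount

theorem MonoidAlgebra.exists_smul_eq_of_single {k M A X : Type*} [Field k] [Monoid M] [Ring A]
    {Y : Type*} [AddCommGroup X] [AddCommGroup Y] [Module A Y] [Module (MonoidAlgebra k M) X]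
    (f : X →+ Y) (h : ∀ x r, ∃ a : A, ∀ y,
      f ((MonoidAlgebra.single x r : MonoidAlgebra k M) • y) = a • f y)
    (b : MonoidAlgebra k M) : ∃ a : A, ∀ y, f (b • y) = a • f y := by
  induction b using MonoidAlgebra.induction_linear with
  | zero => exact ⟨0, by simp⟩
  | add b b' h h' =>
    obtain ⟨a, ha⟩ := h
    obtain ⟨a', ha'⟩ := h'
    exact ⟨a + a', fun y => by rw [add_smul, add_smul, map_add, ha, ha']⟩
  | single x r => exact h x r

theorem MonoidAlgebra.exists_eq_smul_of_single {k M B X : Type*} [Field k] [Monoid M] [Ring B]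
    {Y : Type*} [AddCommGroup X] [AddCommGroup Y] [Module B X] [Module (MonoidAlgebra k M) Y]
    (f : X →+ Y) (h : ∀ x r, ∃ b : B, ∀ y, (MonoidAlgebra.single x r : MonoidAlgebra k M) • f y =
      f (b • y)) (a : MonoidAlgebra k M) : ∃ b : B, ∀ y, a • f y = f (b • y) := by
  induction a using MonoidAlgebra.induction_linear with
  | zero => exact ⟨0, by simp⟩
  | add b b' h h' =>
    obtain ⟨a, ha⟩ := h
    obtain ⟨a', ha'⟩ := h'
    exact ⟨a + a', fun y => by rw [add_smul, add_smul, map_add, ha, ha']⟩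
  | single x r => exact h x r

/-- A subspace that is stable under a representation, as a submodule. -/
def Representation.stableSubmodule {k M U : Type*} [Field k] [Monoid M] [AddCommGroup U]
    [Module k U] (ρ : Representation k M U) (W : Submodule k U)
    (hW : ∀ x, ∀ w ∈ W, ρ x w ∈ W) : Submodule (MonoidAlgebra k M) ρ.asModule where
  carrier := {w | ρ.asModuleEquiv w ∈ W}
  zero_mem' := by simp
  add_mem' {v w} hv hw := by
    simp only [Set.mem_ofPred_eq, map_add] at *
    exact W.add_mem hv hw
  smul_mem' a w hw := by
    simp only [Set.mem_ofPred_eq, Representation.asModuleEquiv_map_smul] at *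
    induction a using MonoidAlgebra.induction_linear with
    | zero => simp
    | add a b ha hb =>
      rw [map_add, LinearMap.add_apply]
      exact W.add_mem ha hb
    | single x r =>
      rw [Representation.asAlgebraHom_single, LinearMap.smul_apply]
      exact W.smul_mem _ (hW x _ hw)

variable {k G M U : Type} [Field k] [Group G] [Fintype G] [Monoid M] [AddCommGroup U]
  [Module k U] {j : G →* M} {ρ : Representation k M U}

namespace RegularSplitting

variable {f : ℕ} (s : RegularSplitting j ρ (Fin f → k))

/-- The embedding of the copies of the regular module. -/
def combineRegular : (Fin f → MonoidAlgebra k G) →+ ρ.asModule where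
  toFun y := ρ.asModuleEquiv.symm (s.combine fun g i => (y i).coeff g)
  map_zero' := by
    rw [← map_zero ρ.asModuleEquiv.symm, ← map_zero s.combine]
    rfl
  map_add' y z := by
    rw [← map_add, ← map_add]
    rfl

theorem asModuleEquiv_combineRegular (y : Fin f → MonoidAlgebra k G) :
    ρ.asModuleEquiv (s.combineRegular y) = s.combine fun g i => (y i).coeff g := rfl

theorem combineRegular_injective : Function.Injective s.combineRegular := by
  intro y z h
  have := Function.LeftInverse.injective s.coeffs_combine (ρ.asModuleEquiv.symm.injective h)
  ext i g
  exact congrFun (congrFun this g) i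

theorem combineRegular_single_smul (h : G) (r : k) (y : Fin f → MonoidAlgebra k G) :
    s.combineRegular ((MonoidAlgebra.single h r : MonoidAlgebra k G) • y) =
      (MonoidAlgebra.single (j h) r : MonoidAlgebra k M) • s.combineRegular y := by
  apply ρ.asModuleEquiv.injective
  rw [Representation.asModuleEquiv_map_smul, Representation.asAlgebraHom_single,
    LinearMap.smul_apply, asModuleEquiv_combineRegular, asModuleEquiv_combineRegular, map_combine,
    ← map_smul]
  congr 1
  ext g i
  simp [MonoidAlgebra.coeff_single_mul_apply]

theorem single_smul_combineRegular {x : M} (hx : x ∉ Set.range j) (r : k)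
    (y : Fin f → MonoidAlgebra k G) :
    (MonoidAlgebra.single x r : MonoidAlgebra k M) • s.combineRegular y = 0 := by
  apply ρ.asModuleEquiv.injective
  rw [Representation.asModuleEquiv_map_smul, Representation.asAlgebraHom_single,
    LinearMap.smul_apply, asModuleEquiv_combineRegular, map_combine_of_notMem _ hx, smul_zero,
    map_zero]

theorem exists_indecDecomp [FiniteDimensional k U] {t : ℕ}
    (ht : IndecDecomp (⊤ : Submodule (MonoidAlgebra k G) (MonoidAlgebra k G)) t) :
    ∃ c ≤ Module.finrank k (LinearMap.ker s.coeffs),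
      IndecDecomp (⊤ : Submodule (MonoidAlgebra k M) ρ.asModule) (f * t + c) := by
  let A := ρ.stableSubmodule (LinearMap.range s.combine) (by
    rintro x _ ⟨y, rfl⟩
    by_cases hx : x ∈ Set.range j
    · obtain ⟨h, rfl⟩ := hx
      exact ⟨_, (s.map_combine h y).symm⟩
    · rw [s.map_combine_of_notMem hx]
      exact Submodule.zero_mem _)
  let B := ρ.stableSubmodule (LinearMap.ker s.coeffs) fun x w => s.map_mem_ker_coeffs x
  obtain ⟨c, hc, hB⟩ := exists_indecDecomp_le_finrank k B
  refine ⟨c, hc, ?_⟩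
  have hA : IndecDecomp A (f * t) := by
    refine IndecDecomp.of_injective s.combineRegular s.combineRegular_injective
      (MonoidAlgebra.exists_eq_smul_of_single _ fun x r => ?_)
      (MonoidAlgebra.exists_smul_eq_of_single _ fun h r =>
        ⟨_, fun y => s.combineRegular_single_smul h r y⟩) A ?_ (ht.pi f)
    · by_cases hx : x ∈ Set.range j
      · obtain ⟨h, rfl⟩ := hx
        exact ⟨_, fun y => (s.combineRegular_single_smul h r y).symm⟩
      · exact ⟨0, fun y => by rw [s.single_smul_combineRegular hx, zero_smul, map_zero]⟩
    · ext w
      constructor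
      · rintro ⟨y, hy⟩
        refine ⟨fun i => MonoidAlgebra.ofCoeff (Finsupp.equivFunOnFinite.symm fun g => y g i), ?_⟩
        apply ρ.asModuleEquiv.injective
        rw [asModuleEquiv_combineRegular, ← hy]
        rfl
      · rintro ⟨y, rfl⟩
        exact ⟨_, rfl⟩
  have hAB : IsCompl A B := by
    have h := s.isCompl
    constructor
    · rw [Submodule.disjoint_def]
      intro w hw hw'
      exact Submodule.disjoint_def.1 h.disjoint _ hw hw'
    · rw [codisjoint_iff, eq_top_iff]
      intro w _
      obtain ⟨u, hu, v, hv, huv⟩ := Submodule.mem_sup.1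
        (h.codisjoint.eq_top ▸ Submodule.mem_top : ρ.asModuleEquiv w ∈ _ ⊔ _)
      exact Submodule.mem_sup.2 ⟨u, hu, v, hv, huv⟩
  rw [← hAB.sup_eq_top]
  exact hA.add hB hAB.disjoint

end RegularSplitting

theorem HasRegularDefect.exists_indecDecomp [FiniteDimensional k U] {D t : ℕ}
    (h : HasRegularDefect j ρ D)
    (ht : IndecDecomp (⊤ : Submodule (MonoidAlgebra k G) (MonoidAlgebra k G)) t) :
    ∃ f, ∃ c ≤ D, Module.finrank k U = Fintype.card G * f + D ∧
      IndecDecomp (⊤ : Submodule (MonoidAlgebra k M) ρ.asModule) (f * t + c) := by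
  obtain ⟨f, hf, ⟨s⟩⟩ := h
  obtain ⟨c, hc, hd⟩ := s.exists_indecDecomp ht
  have := s.finrank_ker_coeffs
  rw [hf, Module.finrank_fin_fun, Nat.add_left_cancel_iff] at this
  exact ⟨f, c, this ▸ hc, hf, hd⟩

end SummandCount

theorem tendsto_summand_ratio {b : ℕ → ℕ} {d g q p t : ℕ} (hd : 0 < d) (hg : 0 < g) (hp : 0 < p)
    (ht : 0 < t) (hq : d ^ p = g + q)
    (hb : ∀ n, ∃ f, ∃ c ≤ d ^ (n % p) * q ^ (n / p),
      d ^ n = g * f + d ^ (n % p) * q ^ (n / p) ∧ b n = f * t + c) :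
    Filter.Tendsto (fun n => (b n : ℝ) / ((d : ℝ) ^ n / g * t)) Filter.atTop (nhds 1) := by
  have hd' : (0 : ℝ) < d := by exact_mod_cast hd
  have hg' : (0 : ℝ) < g := by exact_mod_cast hg
  have ht' : (1 : ℝ) ≤ t := by exact_mod_cast ht
  have hlim : Filter.Tendsto (fun n : ℕ => (1 + (g : ℝ)) * ((q : ℝ) / d ^ p) ^ (n / p))
      Filter.atTop (nhds 0) := by
    have h1 : (q : ℝ) / d ^ p < 1 := by
      rw [div_lt_one (by positivity)]
      exact_mod_cast (by omega : q < d ^ p)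
    have := ((tendsto_pow_atTop_nhds_zero_of_lt_one (by positivity) h1).comp
      (Nat.tendsto_div_const_atTop hp.ne')).const_mul (1 + (g : ℝ))
    simpa using this
  refine tendsto_iff_dist_tendsto_zero.2 (squeeze_zero (fun _ => dist_nonneg) (fun n => ?_) hlim)
  obtain ⟨f, c, hc, hn, hbn⟩ := hb n
  set D := d ^ (n % p) * q ^ (n / p) with hD
  have hDn : ((q : ℝ) / d ^ p) ^ (n / p) = D / d ^ n := by
    rw [hD, div_pow, ← pow_mul, div_eq_div_iff (by positivity) (by positivity)]
    have : (d : ℝ) ^ n = d ^ (n % p) * d ^ (p * (n / p)) := by rw [← pow_add, Nat.mod_add_div]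
    rw [this]
    push_cast
    ring
  have hn' : (d : ℝ) ^ n = g * f + D := by exact_mod_cast hn
  have hc' : (c : ℝ) ≤ D := by exact_mod_cast hc
  have hc0 : (0 : ℝ) ≤ c := by positivity
  have hdn : (0 : ℝ) < (d : ℝ) ^ n := by positivity
  have ht0 : (0 : ℝ) < t := by positivity
  have hsub : (b n : ℝ) / ((d : ℝ) ^ n / g * t) - 1 = (g * c - D * t) / (d ^ n * t) := by
    rw [hbn]
    field_simp
    push_cast
    rw [hn']
    ring
  rw [Real.dist_eq, hsub, hDn, abs_div, abs_of_pos (by positivity : (0 : ℝ) < d ^ n * t),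
    div_le_iff₀ (by positivity)]
  have : (1 + (g : ℝ)) * (D / d ^ n) * (d ^ n * t) = (1 + g) * D * t := by
    field_simp
  rw [this, abs_le]
  have h1 : (0 : ℝ) ≤ g * (D - c) := mul_nonneg hg'.le (by linarith)
  have h2 : (0 : ℝ) ≤ g * D * (t - 1) :=
    mul_nonneg (mul_nonneg hg'.le (by positivity)) (by linarith)
  have h3 : (0 : ℝ) ≤ g * c := by positivity
  have h4 : (0 : ℝ) ≤ (D : ℝ) * t := by positivity
  have h5 : (0 : ℝ) ≤ g * D * t := by positivity
  constructor <;> nlinarith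

section TwoPoints

theorem Equiv.Perm.eq_swap_of_ne_one : ∀ g : Equiv.Perm (Fin 2), g ≠ 1 → g = Equiv.swap 0 1 := by
  decide

open RookMonoid in
theorem RookMonoid.exists_map_eq_smul {k U : Type*} [Field k] [AddCommGroup U] [Module k U]
    (σ : Representation k (RookMonoid 2) U) {c : k}
    (hc : σ (ofPerm (Equiv.swap 0 1)) = c • (1 : Module.End k U)) (x : RookMonoid 2) :
    ∃ a : k, σ x = a • (1 : Module.End k U) ∨ σ x = a • σ (idem {0}) := by
  set g : RookMonoid 2 := ofPerm (Equiv.swap 0 1) with hg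
  set e : RookMonoid 2 := idem {0} with he
  have hee : σ e * σ e = σ e := by
    rw [← map_mul]
    congr 1
    refine ext_succ fun i => ?_
    fin_cases i <;> rfl
  have hx : x = 1 ∨ x = g ∨ x = e ∨ x = e * g ∨ x = g * e ∨ x = g * (e * g) ∨
      x = e * (g * (e * g)) := by
    have key : ∀ a b : Fin 3, (a = b → a = 0) → (a = 1 ∧ b = 2) ∨ (a = 2 ∧ b = 1) ∨
        (a = 0 ∧ b = 2) ∨ (a = 2 ∧ b = 0) ∨ (a = 0 ∧ b = 1) ∨ (a = 1 ∧ b = 0) ∨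
        (a = 0 ∧ b = 0) := by decide
    have hext (y : RookMonoid 2) (h1 : x.1 1 = y.1 1) (h2 : x.1 2 = y.1 2) : x = y :=
      ext_succ fun i => by fin_cases i <;> assumption
    have h12 : x.1 1 = x.1 2 → x.1 1 = 0 := fun h => by
      by_contra h0
      exact absurd (x.2.2 1 2 h h0) (by decide)
    refine (key _ _ h12).imp ?_ (Or.imp ?_ (Or.imp ?_ (Or.imp ?_ (Or.imp ?_ (Or.imp ?_ ?_))))) <;>
      exact fun h => hext _ h.1 h.2
  rcases hx with rfl | rfl | rfl | rfl | rfl | rfl | rfl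
  · exact ⟨1, Or.inl (by simp)⟩
  · exact ⟨c, Or.inl hc⟩
  · exact ⟨1, Or.inr (by simp)⟩
  · exact ⟨c, Or.inr (by simp [hc])⟩
  · exact ⟨c, Or.inr (by simp [hc])⟩
  · exact ⟨c * c, Or.inr (by simp [hc, smul_smul])⟩
  · exact ⟨c * c, Or.inr (by simp [hc, smul_smul, hee])⟩

theorem RookMonoid.indecDecomp_eq_finrank_of_scalar {k U : Type*} [Field k] [AddCommGroup U]
    [Module k U] [FiniteDimensional k U] (σ : Representation k (RookMonoid 2) U) {c : k}
    (hc : σ (ofPerm (Equiv.swap 0 1)) = c • (1 : Module.End k U)) {n : ℕ}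
    (hn : IndecDecomp (⊤ : Submodule (MonoidAlgebra k (RookMonoid 2)) σ.asModule) n) :
    n = Module.finrank k U := by
  have hsmul (x : RookMonoid 2) (r : k) (u : σ.asModule) :
      (MonoidAlgebra.single x r : MonoidAlgebra k (RookMonoid 2)) • u =
        σ.asModuleEquiv.symm (r • σ x (σ.asModuleEquiv u)) := Representation.single_smul σ r x u
  have hee : σ (idem {0}) * σ (idem {0}) = σ (idem {0}) := by
    rw [← map_mul]
    congr 1
    refine ext_succ fun i => ?_
    fin_cases i <;> rfl
  have : FiniteDimensional k σ.asModule := Module.Finite.equiv σ.asModuleEquiv.symm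
  refine (IndecDecomp.eq_finrank_of_idempotent (k := k) (R := MonoidAlgebra k (RookMonoid 2))
    (MonoidAlgebra.single (idem {0}) 1) (fun u => ?_) (fun a => ?_) hn).trans
    σ.asModuleEquiv.finrank_eq
  · rw [hsmul, hsmul]
    simp only [one_smul, LinearEquiv.apply_symm_apply]
    exact congrArg _ (LinearMap.congr_fun hee _)
  · induction a using MonoidAlgebra.induction_linear with
    | zero => exact ⟨0, 0, fun x => by rw [zero_smul, zero_smul, zero_smul, add_zero]⟩
    | add a b ha hb =>
      obtain ⟨s, t, h⟩ := ha
      obtain ⟨s', t', h'⟩ := hb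
      exact ⟨s + s', t + t', fun x => by rw [add_smul, h, h', add_smul, add_smul, add_add_add_comm]⟩
    | single x r =>
      obtain ⟨a, h | h⟩ := exists_map_eq_smul σ hc x
      · refine ⟨r * a, 0, fun u => ?_⟩
        rw [hsmul, h, zero_smul, add_zero]
        exact (mul_smul _ _ _).symm
      · refine ⟨0, r * a, fun u => ?_⟩
        rw [hsmul, hsmul, h, zero_smul, zero_add, one_smul]
        exact (mul_smul _ _ _).symm

theorem indecDecomp_perm_fin_two_eq {k : Type*} [Field k] (h2 : (2 : k) ≠ 0) {n : ℕ}
    (hn : IndecDecomp (⊤ : Submodule (MonoidAlgebra k (Equiv.Perm (Fin 2)))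
      (MonoidAlgebra k (Equiv.Perm (Fin 2)))) n) : n = 2 := by
  let A := MonoidAlgebra k (Equiv.Perm (Fin 2))
  have : FiniteDimensional k A := Module.Finite.equiv (MonoidAlgebra.coeffLinearEquiv k).symm
  have hfin : Module.finrank k A = 2 := by
    rw [(MonoidAlgebra.coeffLinearEquiv k).finrank_eq, Module.finrank_finsupp_self,
      Fintype.card_perm, Fintype.card_fin, Nat.factorial_two]
  let g : A := MonoidAlgebra.single (Equiv.swap 0 1) 1
  have hg : g * g = 1 := by
    rw [MonoidAlgebra.single_mul_single, Equiv.swap_mul_self, mul_one, MonoidAlgebra.one_def]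
  have hee : ((2 : k)⁻¹ • (1 + g)) * ((2 : k)⁻¹ • (1 + g)) = (2 : k)⁻¹ • (1 + g) := by
    have h : (1 + g) * (1 + g) = (2 : k) • (1 + g) := by
      rw [add_mul, mul_add, mul_add, hg, two_smul]
      simp only [one_mul, mul_one]
      abel
    rw [smul_mul_smul_comm, h, smul_smul, mul_assoc, inv_mul_cancel₀ h2, mul_one]
  have hsingle (x : Equiv.Perm (Fin 2)) (r : k) :
      (MonoidAlgebra.single x r : A) = r • MonoidAlgebra.single x 1 := by
    rw [MonoidAlgebra.smul_single, smul_eq_mul, mul_one]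
  refine (IndecDecomp.eq_finrank_of_idempotent (k := k) (R := A) ((2 : k)⁻¹ • (1 + g))
    (fun x => ?_) (fun a => ?_) hn).trans hfin
  · rw [← mul_smul, hee]
  · induction a using MonoidAlgebra.induction_linear with
    | zero => exact ⟨0, 0, fun x => by rw [zero_smul, zero_smul, zero_smul, add_zero]⟩
    | add a b ha hb =>
      obtain ⟨s, t, h⟩ := ha
      obtain ⟨s', t', h'⟩ := hb
      exact ⟨s + s', t + t', fun x => by rw [add_smul, h, h', add_smul, add_smul, add_add_add_comm]⟩
    | single x r =>
      by_cases hx : x = 1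
      · refine ⟨r, 0, fun y => ?_⟩
        rw [hx, hsingle, ← MonoidAlgebra.one_def, smul_assoc, one_smul, zero_smul, add_zero]
      · rw [Equiv.Perm.eq_swap_of_ne_one x hx]
        refine ⟨-r, 2 * r, fun y => ?_⟩
        rw [hsingle, smul_assoc, smul_assoc, smul_smul, mul_right_comm, mul_inv_cancel₀ h2, one_mul,
          add_smul, one_smul, smul_add, neg_smul, neg_add_cancel_left]

end TwoPoints

theorem IndecDecomp.eq_bot {L : Type*} [Lattice L] [OrderBot L] {a : L} (h : IndecDecomp a 0) :
    a = ⊥ := by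
  cases h
  rfl

theorem Representation.tensorPower_apply_of_eq_smul {k M V : Type*} [Field k] [Monoid M]
    [AddCommGroup V] [Module k V] {ρ : Representation k M V} {x : M} {c : k}
    (hx : ρ x = c • (1 : Module.End k V)) (n : ℕ) :
    ρ.tensorPower n x = c ^ n • (1 : Module.End k (⨂[k]^n V)) := by
  refine PiTensorProduct.ext (MultilinearMap.ext fun v => ?_)
  have h := MultilinearMap.map_smul_univ (PiTensorProduct.tprod k) (fun _ : Fin n => c) v
  rw [Finset.prod_const, Finset.card_univ, Fintype.card_fin] at h
  simp only [LinearMap.compMultilinearMap_apply, Representation.tensorPower_tprod, hx]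
  exact h

theorem RookMonoid.exists_indecDecomp_tensorPower {k V : Type} [Field k] [AddCommGroup V]
    [Module k V] [FiniteDimensional k V] [Nontrivial V] {m : ℕ}
    {ρ : Representation k (RookMonoid m) V}
    (hρ : ∀ (x : RookMonoid m) (c : k), c ≠ 0 → ρ x = c • 1 → x = 1) {t : ℕ}
    (ht : IndecDecomp (⊤ : Submodule (MonoidAlgebra k (Equiv.Perm (Fin m)))
      (MonoidAlgebra k (Equiv.Perm (Fin m)))) t) :
    ∃ p > 0, ∃ q, Module.finrank k V ^ p = m.factorial + q ∧
      ∀ n, ∃ b f, ∃ c ≤ Module.finrank k V ^ (n % p) * q ^ (n / p),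
        Module.finrank k V ^ n =
          m.factorial * f + Module.finrank k V ^ (n % p) * q ^ (n / p) ∧ b = f * t + c ∧
        IndecDecomp (⊤ : Submodule (MonoidAlgebra k (RookMonoid m)) (ρ.tensorPower n).asModule)
          b := by
  have := Fintype.ofFinite (RookMonoid m)
  obtain ⟨w, μ, h1, h0⟩ := exists_tensorPower_separating ρ hρ
  obtain ⟨q, hq, hdef⟩ := exists_hasRegularDefect_of_separating _ h1 h0
  rw [finrank_tensorPower] at hq
  refine ⟨_, Fintype.card_pos, q, hq, fun n => ?_⟩
  have h := hdef.tensorPower_add_mul (n % Fintype.card (RookMonoid m))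
    (n / Fintype.card (RookMonoid m))
  rw [Nat.mod_add_div'] at h
  obtain ⟨f, c, hc, hn, hd⟩ := h.exists_indecDecomp ht
  rw [finrank_tensorPower, Fintype.card_perm, Fintype.card_fin] at hn
  exact ⟨_, f, c, hc, hn, rfl, hd⟩

theorem RookMonoid.eq_two_of_map_eq_smul_one {k V : Type*} [Field k] [AddCommGroup V]
    [Module k V] [Nontrivial V] {m : ℕ} {ρ : Representation k (RookMonoid m) V}
    (hρ : ∀ x : RookMonoid m, ρ x = 1 → x = 1) {x : RookMonoid m} {c : k} (hc : c ≠ 0)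
    (hx : ρ x = c • 1) (hx1 : x ≠ 1) : m = 2 := by
  by_contra hm
  exact hx1 (eq_one_of_map_eq_smul_one hρ hm hc hx)

theorem RookMonoid.map_swap_eq_smul_one {k V : Type*} [Field k] [AddCommGroup V]
    [Module k V] [Nontrivial V] {ρ : Representation k (RookMonoid 2) V}
    (hρ : ∀ x : RookMonoid 2, ρ x = 1 → x = 1) {x : RookMonoid 2} {c : k} (hc : c ≠ 0)
    (hx : ρ x = c • 1) (hx1 : x ≠ 1) :
    ρ (ofPerm (Equiv.swap 0 1)) = c • (1 : Module.End k V) ∧ (2 : k) ≠ 0 := by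
  obtain ⟨g, rfl⟩ := mem_range_ofPerm_of_map_eq_smul_one hρ hc hx
  obtain rfl := Equiv.Perm.eq_swap_of_ne_one g (by rintro rfl; exact hx1 (map_one _))
  refine ⟨hx, fun h2 => hx1 (hρ _ ?_)⟩
  have hcc : c * c = 1 := by
    have h : ρ (ofPerm (Equiv.swap 0 1)) * ρ (ofPerm (Equiv.swap 0 1)) = 1 := by
      rw [← map_mul, ← map_mul, Equiv.swap_mul_self, map_one, map_one]
    rw [hx, smul_mul_smul_comm, mul_one] at h
    exact smul_left_injective k (one_ne_zero (α := Module.End k V)) (by simpa using h)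
  have hc1 : c = 1 := by
    have : (c - 1) * (c - 1) = 0 := by linear_combination hcc + (1 - c) * h2
    simpa [sub_eq_zero] using this
  rw [hx, hc1, one_smul]

/-- Let `k` be an algebraically closed field, `Ro_m` the rook monoid on `m` points, and
`V` a nonzero finite-dimensional `kRo_m`-module on which only `1` acts as the identity.
Let `S_1, …, S_N` be a complete list of pairwise non-isomorphic simple modules over the
group algebra `k[S_m]`. Then the number `b(n)` of indecomposable summands of `V^{⊗n}`
satisfies `b(n)/a(n) → 1`, where `a(n) = ((dim_k V)^n/m!)·∑_i dim_k S_i`. -/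
theorem rookMonoid_tendsto_summands_ratio
    {k V : Type} [Field k] [IsAlgClosed k] (m : ℕ)
    [AddCommGroup V] [Module k V] [FiniteDimensional k V] [Nontrivial V]
    (ρ : Representation k (RookMonoid m) V)
    (hρ : ∀ x : RookMonoid m, ρ x = 1 → x = 1)
    (N : ℕ) (S : Fin N → Type)
    [∀ i, AddCommGroup (S i)]
    [∀ i, Module (MonoidAlgebra k (Equiv.Perm (Fin m))) (S i)]
    (hsimple : ∀ i, IsSimpleModule (MonoidAlgebra k (Equiv.Perm (Fin m))) (S i))
    (hpairwise : ∀ i j, i ≠ j →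
      IsEmpty (S i ≃ₗ[MonoidAlgebra k (Equiv.Perm (Fin m))] S j))
    (hcomplete : ∀ (T : Type) [AddCommGroup T]
      [Module (MonoidAlgebra k (Equiv.Perm (Fin m))) T],
      IsSimpleModule (MonoidAlgebra k (Equiv.Perm (Fin m))) T →
      ∃ i, Nonempty (T ≃ₗ[MonoidAlgebra k (Equiv.Perm (Fin m))] S i)) :
    ∃ b : ℕ → ℕ,
      (∀ n : ℕ, ∃ (ι : Type) (_ : Fintype ι) (_ : DecidableEq ι)
        (Wf : ι → Submodule (MonoidAlgebra k (RookMonoid m)) ((ρ.tensorPower n).asModule)),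
        DirectSum.IsInternal Wf ∧
        (∀ i, IsIndecomposableModule (MonoidAlgebra k (RookMonoid m)) (Wf i)) ∧
        Fintype.card ι = b n) ∧
      Filter.Tendsto
        (fun n : ℕ => (b n : ℝ) /
          (((Module.finrank k V : ℝ) ^ n / (m.factorial : ℝ)) *
            ∑ i : Fin N,
              (Module.finrank k
                (RestrictScalars k (MonoidAlgebra k (Equiv.Perm (Fin m))) (S i)) : ℝ)))
        Filter.atTop (nhds 1) := by
  have : FiniteDimensional k (MonoidAlgebra k (Equiv.Perm (Fin m))) :=
    Module.Finite.equiv (MonoidAlgebra.coeffLinearEquiv k).symm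
  have ht := indecDecomp_regular (k := k) S hsimple hpairwise hcomplete
  simp_rw [← Nat.cast_sum]
  generalize ∑ i, Module.finrank k
    (RestrictScalars k (MonoidAlgebra k (Equiv.Perm (Fin m))) (S i)) = t at ht ⊢
  have hdim : 0 < Module.finrank k V := Module.finrank_pos
  suffices h : ∃ b : ℕ → ℕ,
      (∀ n, IndecDecomp (⊤ : Submodule (MonoidAlgebra k (RookMonoid m))
        (ρ.tensorPower n).asModule) (b n)) ∧
      Filter.Tendsto (fun n : ℕ => (b n : ℝ) / ((Module.finrank k V : ℝ) ^ n / m.factorial * t))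
        Filter.atTop (nhds 1) by
    obtain ⟨b, hb, hlim⟩ := h
    exact ⟨b, fun n => (hb n).exists_isInternal, hlim⟩
  by_cases hsep : ∀ (x : RookMonoid m) (c : k), c ≠ 0 → ρ x = c • 1 → x = 1
  · have htpos : 0 < t := by
      rw [Nat.pos_iff_ne_zero]
      rintro rfl
      exact top_ne_bot ht.eq_bot
    obtain ⟨p, hp, q, hq, hn⟩ := RookMonoid.exists_indecDecomp_tensorPower hsep ht
    choose b hb using hn
    refine ⟨b, fun n => ?_, tendsto_summand_ratio hdim m.factorial_pos hp htpos hq fun n => ?_⟩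
    · obtain ⟨f, c, -, -, -, h⟩ := hb n
      exact h
    · obtain ⟨f, c, hc, hd, hbn, -⟩ := hb n
      exact ⟨f, c, hc, hd, hbn⟩
  · push Not at hsep
    obtain ⟨x, c, hc, hx, hx1⟩ := hsep
    obtain rfl := RookMonoid.eq_two_of_map_eq_smul_one hρ hc hx hx1
    obtain ⟨hswap, h2⟩ := RookMonoid.map_swap_eq_smul_one hρ hc hx hx1
    obtain rfl := indecDecomp_perm_fin_two_eq h2 ht
    refine ⟨fun n => Module.finrank k V ^ n, fun n => ?_, ?_⟩
    · have : FiniteDimensional k (ρ.tensorPower n).asModule :=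
        Module.Finite.equiv (ρ.tensorPower n).asModuleEquiv.symm
      obtain ⟨l, -, hl⟩ := exists_indecDecomp_le_finrank k
        (⊤ : Submodule (MonoidAlgebra k (RookMonoid 2)) (ρ.tensorPower n).asModule)
      beta_reduce
      rwa [← finrank_tensorPower, ← RookMonoid.indecDecomp_eq_finrank_of_scalar _
        (Representation.tensorPower_apply_of_eq_smul hswap n) hl]
    · refine tendsto_const_nhds.congr fun n => ?_
      have : (Module.finrank k V : ℝ) ^ n ≠ 0 := by positivity
      simp [this]

end
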